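/- Let u solve u_t = u_xx + f(u) on ℝ × (0,∞) with f locally Lipschitz and u bounded, and suppose the initial value u₀ is continuous and has finite limits θ⁻ = lim_{x→−∞} u₀(x) and θ⁺ = lim_{x→+∞} u₀(x). Then for each t > 0 the limits θ±(t) = lim_{x→±∞} u(x,t) exist and solve the ODE θ' = f(θ) with θ±(0) = θ±. -/

import Mathlib

open Set Filter Topology MeasureTheory

/-- The one-dimensional heat kernel. -/
noncomputable def heatKer (τ z : ℝ) : ℝ :=
  (√(4 * Real.pi * τ))⁻¹ * Real.exp (-z ^ 2 / (4 * τ))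

lemma heatKer_nonneg (τ z : ℝ) : 0 ≤ heatKer τ z := by
  unfold heatKer; positivity

lemma heatKer_neg (τ z : ℝ) : heatKer τ (-z) = heatKer τ z := by
  simp [heatKer]

lemma heatKer_eq_gaussianPDFReal {τ : ℝ} (hτ : 0 < τ) (x y : ℝ) :
    heatKer τ (y - x) = ProbabilityTheory.gaussianPDFReal x (Real.toNNReal (2 * τ)) y := by
  rw [heatKer, ProbabilityTheory.gaussianPDFReal, Real.coe_toNNReal _ (by positivity)]
  ring_nf

lemma toNNReal_two_mul_ne_zero {τ : ℝ} (hτ : 0 < τ) : Real.toNNReal (2 * τ) ≠ 0 := by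
  simp [hτ]

lemma integrable_heatKer {τ : ℝ} (hτ : 0 < τ) (x : ℝ) :
    Integrable (fun y => heatKer τ (y - x)) := by
  simp_rw [heatKer_eq_gaussianPDFReal hτ]
  exact ProbabilityTheory.integrable_gaussianPDFReal _ _

lemma integral_heatKer {τ : ℝ} (hτ : 0 < τ) (x : ℝ) : ∫ y, heatKer τ (y - x) = 1 := by
  simp_rw [heatKer_eq_gaussianPDFReal hτ]
  exact ProbabilityTheory.integral_gaussianPDFReal_eq_one _ (toNNReal_two_mul_ne_zero hτ)

lemma integral_mul_heatKer_eq_gaussianReal {τ : ℝ} (hτ : 0 < τ) (x : ℝ) (h : ℝ → ℝ) :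
    ∫ y, h y * heatKer τ (y - x) =
      ∫ y, h y ∂ProbabilityTheory.gaussianReal x (Real.toNNReal (2 * τ)) := by
  rw [ProbabilityTheory.integral_gaussianReal_eq_integral_smul (toNNReal_two_mul_ne_zero hτ)]
  simp_rw [heatKer_eq_gaussianPDFReal hτ, smul_eq_mul, mul_comm]

lemma integrable_mul_heatKer_of_integral_ne_zero {τ x : ℝ} {h : ℝ → ℝ}
    (hne : ∫ y, h y * heatKer τ (y - x) ≠ 0) : Integrable (fun y => h y * heatKer τ (y - x)) :=
  not_imp_comm.1 integral_undef hne

lemma integral_sq_mul_heatKer {τ : ℝ} (hτ : 0 < τ) (x : ℝ) :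
    ∫ y, (y - x) ^ 2 * heatKer τ (y - x) = 2 * τ := by
  rw [integral_mul_heatKer_eq_gaussianReal hτ x (fun y => (y - x) ^ 2)]
  have h := ProbabilityTheory.variance_fun_id_gaussianReal (μ := x) (v := Real.toNNReal (2 * τ))
  rw [ProbabilityTheory.variance_eq_integral (by fun_prop),
    ProbabilityTheory.integral_id_gaussianReal, Real.coe_toNNReal _ (by positivity)] at h
  exact h

lemma integrable_sq_mul_heatKer {τ : ℝ} (hτ : 0 < τ) (x : ℝ) :
    Integrable (fun y => (y - x) ^ 2 * heatKer τ (y - x)) := by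
  refine integrable_mul_heatKer_of_integral_ne_zero (h := fun y => (y - x) ^ 2) ?_
  rw [integral_sq_mul_heatKer hτ]
  positivity

lemma integral_exp_neg_mul_heatKer {τ : ℝ} (hτ : 0 < τ) (x : ℝ) :
    ∫ y, Real.exp (-y) * heatKer τ (y - x) = Real.exp (-x + τ) := by
  rw [integral_mul_heatKer_eq_gaussianReal hτ x (fun y => Real.exp (-y))]
  have h := congrFun (ProbabilityTheory.mgf_id_gaussianReal
    (μ := x) (v := Real.toNNReal (2 * τ))) (-1)
  rw [ProbabilityTheory.mgf, Real.coe_toNNReal _ (by positivity)] at h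
  simp only [id, neg_one_mul] at h
  rw [h]
  ring_nf

lemma integrable_exp_neg_mul_heatKer {τ : ℝ} (hτ : 0 < τ) (x : ℝ) :
    Integrable (fun y => Real.exp (-y) * heatKer τ (y - x)) := by
  refine integrable_mul_heatKer_of_integral_ne_zero (h := fun y => Real.exp (-y)) ?_
  rw [integral_exp_neg_mul_heatKer hτ]
  positivity

lemma heatKer_le {κ τ : ℝ} (hκ : 0 < κ) (h : κ ≤ τ) (z : ℝ) :
    heatKer τ z ≤ (√(4 * Real.pi * κ))⁻¹ := by
  have hτ : 0 < τ := hκ.trans_le h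
  have h1 : Real.exp (-z ^ 2 / (4 * τ)) ≤ 1 := by
    rw [Real.exp_le_one_iff, neg_div]
    have : 0 ≤ z ^ 2 / (4 * τ) := by positivity
    linarith
  have h2 : (√(4 * Real.pi * τ))⁻¹ ≤ (√(4 * Real.pi * κ))⁻¹ := by
    gcongr
  calc heatKer τ z ≤ (√(4 * Real.pi * τ))⁻¹ * 1 := by unfold heatKer; gcongr
    _ ≤ _ := by rwa [mul_one]

lemma hasDerivAt_heatKer_space (τ z : ℝ) :
    HasDerivAt (heatKer τ) (-z / (2 * τ) * heatKer τ z) z := by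
  have h := ((((hasDerivAt_id z).pow 2).neg.div_const (4 * τ)).exp).const_mul
    (√(4 * Real.pi * τ))⁻¹
  refine HasDerivAt.congr_deriv h ?_
  simp only [heatKer, id, Pi.neg_apply, Pi.pow_apply]
  rcases eq_or_ne τ 0 with rfl | hτ
  · simp
  · simp; field_simp; ring

lemma hasDerivAt_heatKer_space_deriv {τ : ℝ} (hτ : 0 < τ) (z : ℝ) :
    HasDerivAt (fun z => -z / (2 * τ) * heatKer τ z)
      ((z ^ 2 / (4 * τ ^ 2) - 1 / (2 * τ)) * heatKer τ z) z := by
  have h := ((hasDerivAt_id z).neg.div_const (2 * τ)).mul (hasDerivAt_heatKer_space τ z)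
  refine HasDerivAt.congr_deriv h ?_
  simp
  field_simp
  ring

lemma hasDerivAt_heatKer_time {τ : ℝ} (hτ : 0 < τ) (z : ℝ) :
    HasDerivAt (fun τ => heatKer τ z)
      ((z ^ 2 / (4 * τ ^ 2) - 1 / (2 * τ)) * heatKer τ z) τ := by
  have hp : 0 < 4 * Real.pi * τ := by positivity
  have h1 := (((hasDerivAt_id τ).const_mul (4 * Real.pi)).sqrt hp.ne').inv (by simp; positivity)
  have h2 := (((hasDerivAt_id τ).const_mul 4).inv (by simp; positivity)).const_mul (-z ^ 2)
  have h := h1.mul h2.exp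
  have hs : √(4 * Real.pi * τ) ^ 2 = 4 * Real.pi * τ := Real.sq_sqrt hp.le
  refine (HasDerivAt.congr_deriv h ?_).congr_of_eventuallyEq
    (Eventually.of_forall fun s => by simp [heatKer, div_eq_mul_inv])
  simp only [heatKer, id, Pi.inv_apply, div_eq_mul_inv]
  field_simp
  rw [hs]
  field_simp
  ring

lemma abs_integral_mul_heatKer_le {τ : ℝ} (hτ : 0 < τ) {x α β : ℝ} {h : ℝ → ℝ}
    (hh : ∀ y, |h y| ≤ α + β * (y - x) ^ 2) :
    |∫ y, h y * heatKer τ (y - x)| ≤ α + 2 * β * τ := by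
  have hint : Integrable (fun y => α * heatKer τ (y - x) +
      β * ((y - x) ^ 2 * heatKer τ (y - x))) :=
    ((integrable_heatKer hτ x).const_mul α).add ((integrable_sq_mul_heatKer hτ x).const_mul β)
  have := norm_integral_le_of_norm_le hint (f := fun y => h y * heatKer τ (y - x))
    (ae_of_all _ fun y => by
      rw [norm_mul, Real.norm_eq_abs, Real.norm_eq_abs, abs_of_nonneg (heatKer_nonneg _ _)]
      have := mul_le_mul_of_nonneg_right (hh y) (heatKer_nonneg τ (y - x))
      linarith)
  rw [integral_add ((integrable_heatKer hτ x).const_mul α)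
    ((integrable_sq_mul_heatKer hτ x).const_mul β), integral_const_mul, integral_const_mul,
    integral_heatKer hτ, integral_sq_mul_heatKer hτ] at this
  rw [Real.norm_eq_abs] at this
  linarith

/-- The heat kernel is an approximate identity on bounded continuous functions. -/
lemma tendsto_integral_mul_heatKer {v : ℝ → ℝ} {M x : ℝ} (hv : Continuous v)
    (hM : ∀ y, |v y| ≤ M) :
    Tendsto (fun κ => ∫ y, v y * heatKer κ (y - x)) (𝓝[>] 0) (𝓝 (v x)) := by
  rw [Metric.tendsto_nhds]
  intro ε hε
  obtain ⟨δ, hδ, hvδ⟩ := Metric.continuousAt_iff.1 hv.continuousAt (ε / 2) (half_pos hε)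
  have hM0 : 0 ≤ M := (abs_nonneg _).trans (hM 0)
  have hsmall : ∀ᶠ κ in 𝓝[>] (0 : ℝ), ε / 2 + 2 * (2 * M / δ ^ 2) * κ < ε := by
    refine nhdsWithin_le_nhds ?_
    have hc : Continuous fun κ : ℝ => ε / 2 + 2 * (2 * M / δ ^ 2) * κ := by fun_prop
    exact hc.continuousAt.eventually_lt continuousAt_const (by simp; linarith)
  filter_upwards [hsmall, self_mem_nhdsWithin] with κ hκ hκ0
  have hκ0 : 0 < κ := hκ0
  have hint : Integrable fun y => v y * heatKer κ (y - x) :=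
    (integrable_heatKer hκ0 x).bdd_mul hv.aestronglyMeasurable (ae_of_all _ hM)
  have heq : (∫ y, v y * heatKer κ (y - x)) - v x =
      ∫ y, (v y - v x) * heatKer κ (y - x) := by
    simp_rw [sub_mul]
    rw [integral_sub hint ((integrable_heatKer hκ0 x).const_mul _), integral_const_mul,
      integral_heatKer hκ0, mul_one]
  rw [Real.dist_eq, heq]
  refine (abs_integral_mul_heatKer_le hκ0 fun y => ?_).trans_lt hκ
  rcases lt_or_ge (dist y x) δ with h | h
  · have := (hvδ h).le
    rw [Real.dist_eq] at this
    have h2 : 0 ≤ 2 * M / δ ^ 2 * (y - x) ^ 2 := by positivity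
    linarith
  · have h1 : 1 ≤ (y - x) ^ 2 / δ ^ 2 := by
      rw [le_div_iff₀ (by positivity), one_mul, ← sq_abs (y - x)]
      rw [Real.dist_eq] at h
      gcongr
    have h2 : |v y - v x| ≤ 2 * M := (abs_sub _ _).trans (by linarith [hM y, hM x])
    calc |v y - v x| ≤ 2 * M * 1 := by linarith
      _ ≤ 2 * M * ((y - x) ^ 2 / δ ^ 2) := by gcongr
      _ ≤ ε / 2 + 2 * M / δ ^ 2 * (y - x) ^ 2 := by
        have : 2 * M * ((y - x) ^ 2 / δ ^ 2) = 2 * M / δ ^ 2 * (y - x) ^ 2 := by ring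
        linarith

/-- `φ` is a `C²` test function supported in `[-r, r]` with derivatives `φ₁`, `φ₂`. -/
structure IsTest (r : ℝ) (φ φ₁ φ₂ : ℝ → ℝ) : Prop where
  d1 : ∀ y, HasDerivAt φ (φ₁ y) y
  d2 : ∀ y, HasDerivAt φ₁ (φ₂ y) y
  cont₂ : Continuous φ₂
  zero : ∀ y, r ≤ |y| → φ y = 0 ∧ φ₁ y = 0 ∧ φ₂ y = 0

lemma IsTest.cont {r : ℝ} {φ φ₁ φ₂ : ℝ → ℝ} (h : IsTest r φ φ₁ φ₂) : Continuous φ :=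
  continuous_iff_continuousAt.2 fun y => (h.d1 y).continuousAt

lemma IsTest.cont₁ {r : ℝ} {φ φ₁ φ₂ : ℝ → ℝ} (h : IsTest r φ φ₁ φ₂) : Continuous φ₁ :=
  continuous_iff_continuousAt.2 fun y => (h.d2 y).continuousAt

lemma IsTest.mono {r r' : ℝ} {φ φ₁ φ₂ : ℝ → ℝ} (h : IsTest r φ φ₁ φ₂) (hr : r ≤ r') :
    IsTest r' φ φ₁ φ₂ :=
  ⟨h.d1, h.d2, h.cont₂, fun y hy => h.zero y (hr.trans hy)⟩

/-- The weak form of `w_t = w_yy + g` at time `s` on `[-r, r]`, with a right time derivative. -/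
def WeakAt (w g : ℝ → ℝ → ℝ) (r s : ℝ) : Prop :=
  ∀ φ φ₁ φ₂, IsTest r φ φ₁ φ₂ →
    HasDerivWithinAt (fun τ => ∫ y, w y τ * φ y) (∫ y, (w y s * φ₂ y + g y s * φ y)) (Ici s) s

lemma WeakAt.mono {w g : ℝ → ℝ → ℝ} {r r' s : ℝ} (h : WeakAt w g r' s) (hr : r ≤ r') :
    WeakAt w g r s := fun φ φ₁ φ₂ hφ => h φ φ₁ φ₂ (hφ.mono hr)

lemma hasCompactSupport_of_zero {r : ℝ} {h : ℝ → ℝ} (h0 : ∀ y, r ≤ |y| → h y = 0) :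
    HasCompactSupport h := by
  refine HasCompactSupport.of_support_subset_isCompact (isCompact_Icc (a := -r) (b := r)) ?_
  intro y hy
  by_contra hc
  refine hy (h0 y ?_)
  by_contra hlt
  exact hc (abs_le.1 (not_le.1 hlt).le)

lemma integrable_of_zero {r : ℝ} {h : ℝ → ℝ} (hc : Continuous h)
    (h0 : ∀ y, r ≤ |y| → h y = 0) : Integrable h :=
  hc.integrable_of_hasCompactSupport (hasCompactSupport_of_zero h0)

lemma exists_abs_le_of_zero {r : ℝ} {h : ℝ → ℝ} (hc : Continuous h)
    (h0 : ∀ y, r ≤ |y| → h y = 0) : ∃ C, 0 ≤ C ∧ ∀ y, |h y| ≤ C := by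
  obtain ⟨C, hC⟩ := (hasCompactSupport_of_zero h0).exists_bound_of_continuous hc
  exact ⟨C, (norm_nonneg _).trans (hC 0), hC⟩

lemma integrable_indicator_Ioo_const (r L : ℝ) :
    Integrable ((Ioo (-r) r).indicator fun _ => L) :=
  (integrable_indicator_iff measurableSet_Ioo).2 (by simp)

lemma abs_le_indicator_Ioo {r L : ℝ} {h : ℝ → ℝ} (hL : ∀ y, |y| < r → |h y| ≤ L)
    (h0 : ∀ y, r ≤ |y| → h y = 0) (y : ℝ) : |h y| ≤ (Ioo (-r) r).indicator (fun _ => L) y := by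
  rcases lt_or_ge |y| r with hy | hy
  · rw [indicator_of_mem (show y ∈ Ioo (-r) r from abs_lt.1 hy)]
    exact hL y hy
  · rw [h0 y hy, abs_zero, indicator_of_notMem]
    exact fun hc => absurd (abs_lt.2 hc) (not_lt.2 hy)

lemma hasDerivWithinAt_integral_mul_moving {w g Φ : ℝ → ℝ → ℝ} {Φ₁ Φ₂ Φs : ℝ → ℝ}
    {M L r s b : ℝ} (hsb : s < b) (hM : ∀ y, ∀ τ ∈ Ioo s b, |w y τ| ≤ M)
    (hwx : ∀ τ ∈ Ioo s b, Continuous fun y => w y τ)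
    (hwt : ∀ y, ContinuousWithinAt (w y) (Ioi s) s)
    (hweak : WeakAt w g r s) (hΦ : IsTest r (Φ s) Φ₁ Φ₂)
    (hΦc : ∀ τ ∈ Ioo s b, Continuous (Φ τ)) (hΦ0 : ∀ τ y, r ≤ |y| → Φ τ y = 0)
    (hL : ∀ τ ∈ Ioo s b, ∀ y, |y| < r → |Φ τ y - Φ s y| ≤ L * (τ - s))
    (hd : ∀ y, HasDerivWithinAt (fun τ => Φ τ y) (Φs y) (Ici s) s) :
    HasDerivWithinAt (fun τ => ∫ y, w y τ * Φ τ y)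
      ((∫ y, w y s * Φs y) + ∫ y, (w y s * Φ₂ y + g y s * Φ s y)) (Ici s) s := by
  have hB := hweak _ _ _ hΦ
  have hnhds : Ioo s b ∈ 𝓝[>] s := Ioo_mem_nhdsGT hsb
  have hA : HasDerivWithinAt (fun τ => ∫ y, w y τ * (Φ τ y - Φ s y)) (∫ y, w y s * Φs y)
      (Ici s) s := by
    rw [← hasDerivWithinAt_Ioi_iff_Ici, hasDerivWithinAt_iff_tendsto_slope' (by simp)]
    have hslope : ∀ τ, slope (fun τ => ∫ y, w y τ * (Φ τ y - Φ s y)) s τ =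
        ∫ y, w y τ * slope (fun τ => Φ τ y) s τ := by
      intro τ
      simp only [slope_def_module, sub_self, mul_zero, integral_zero, sub_zero, smul_eq_mul]
      rw [← integral_const_mul]
      congr 1 with y
      ring
    simp_rw [funext hslope]
    refine tendsto_integral_filter_of_dominated_convergence
      ((Ioo (-r) r).indicator fun _ => M * L) ?_ ?_ (integrable_indicator_Ioo_const _ _) ?_
    · filter_upwards [hnhds] with τ hτ
      have h1 := hwx τ hτ
      have h2 := hΦc τ hτ
      have h3 := hΦ.cont
      simp only [slope_def_module, smul_eq_mul]
      exact Continuous.aestronglyMeasurable (by fun_prop)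
    · filter_upwards [hnhds] with τ hτ
      refine ae_of_all _ (abs_le_indicator_Ioo (fun y hy => ?_) fun y hy => ?_)
      · have hpos : 0 < τ - s := sub_pos.2 hτ.1
        rw [abs_mul]
        have h1 : |slope (fun τ => Φ τ y) s τ| ≤ L := by
          rw [slope_def_field, abs_div, abs_of_pos hpos, div_le_iff₀ hpos]
          exact hL τ hτ y hy
        exact mul_le_mul (hM y τ hτ) h1 (abs_nonneg _) ((abs_nonneg _).trans (hM y τ hτ))
      · simp [slope_def_field, hΦ0 τ y hy, hΦ0 s y hy]
    · refine ae_of_all _ fun y => (hwt y).tendsto.mul ?_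
      have := hd y
      rwa [← hasDerivWithinAt_Ioi_iff_Ici, hasDerivWithinAt_iff_tendsto_slope' (by simp)] at this
  refine ((hA.add hB).Ioi_of_Ici.congr_of_eventuallyEq ?_ ?_).Ici_of_Ioi
  · filter_upwards [hnhds] with τ hτ
    have h1 := hwx τ hτ
    have h2 := hΦc τ hτ
    have h3 := hΦ.cont
    simp only [Pi.add_apply]
    rw [← integral_add]
    · congr 1 with y; ring
    · exact integrable_of_zero (r := r) (by fun_prop)
        fun y hy => by simp [hΦ0 τ y hy, hΦ0 s y hy]
    · exact integrable_of_zero (r := r) (by fun_prop) fun y hy => by simp [hΦ0 s y hy]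
  · simp

lemma abs_heatKer_sub_le {κ τ τ' z : ℝ} (hκ : 0 < κ) (hτ : κ ≤ τ) (hτ' : κ ≤ τ') :
    |heatKer τ z - heatKer τ' z| ≤
      (z ^ 2 / (4 * κ ^ 2) + 1 / (2 * κ)) * (√(4 * Real.pi * κ))⁻¹ * |τ - τ'| := by
  refine Convex.norm_image_sub_le_of_norm_hasDerivWithin_le (s := Ici κ)
    (f := fun τ => heatKer τ z) (fun θ hθ =>
      (hasDerivAt_heatKer_time (hκ.trans_le hθ) z).hasDerivWithinAt) ?_ (convex_Ici _) hτ' hτ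
  intro θ hθ
  have hθ : κ ≤ θ := hθ
  have hθ0 : 0 < θ := hκ.trans_le hθ
  rw [norm_mul, Real.norm_eq_abs, Real.norm_eq_abs, abs_of_nonneg (heatKer_nonneg _ _)]
  refine mul_le_mul ?_ (heatKer_le hκ hθ z) (heatKer_nonneg _ _) (by positivity)
  refine (abs_sub _ _).trans ?_
  rw [abs_of_nonneg (by positivity), abs_of_nonneg (by positivity)]
  gcongr

lemma continuous_heatKer (τ : ℝ) : Continuous (heatKer τ) := by
  unfold heatKer; fun_prop

lemma isTest_mul_heatKer {r x τ : ℝ} {ζ ζ₁ ζ₂ : ℝ → ℝ} (hτ : 0 < τ) (hζ : IsTest r ζ ζ₁ ζ₂) :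
    IsTest r (fun y => ζ y * heatKer τ (y - x))
      (fun y => ζ₁ y * heatKer τ (y - x) + ζ y * (-(y - x) / (2 * τ) * heatKer τ (y - x)))
      (fun y => ζ₂ y * heatKer τ (y - x) + 2 * ζ₁ y * (-(y - x) / (2 * τ) * heatKer τ (y - x)) +
        ζ y * (((y - x) ^ 2 / (4 * τ ^ 2) - 1 / (2 * τ)) * heatKer τ (y - x))) where
  d1 y := (hζ.d1 y).mul ((hasDerivAt_heatKer_space τ (y - x)).comp_sub_const y x)
  d2 y := by
    have h0 := (hasDerivAt_heatKer_space τ (y - x)).comp_sub_const y x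
    have h1 := (hasDerivAt_heatKer_space_deriv hτ (y - x)).comp_sub_const y x
    refine (((hζ.d2 y).mul h0).add ((hζ.d1 y).mul h1)).congr_deriv ?_
    ring
  cont₂ := by
    have h0 := continuous_heatKer τ
    have h1 := hζ.cont
    have h2 := hζ.cont₁
    have h3 := hζ.cont₂
    fun_prop
  zero y hy := by
    obtain ⟨h0, h1, h2⟩ := hζ.zero y hy
    simp [h0, h1, h2]

/-- Testing `w_t = w_yy + g` against a truncated backward heat kernel. -/
lemma heatKer_duality_estimate {w g : ℝ → ℝ → ℝ} {M r a b κ x A B d : ℝ} {ζ ζ₁ ζ₂ E E' : ℝ → ℝ}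
    (hab : a ≤ b) (hκ : 0 < κ) (hM : ∀ y, ∀ s ∈ Icc a b, |w y s| ≤ M)
    (hwx : ∀ s ∈ Icc a b, Continuous fun y => w y s)
    (hwt : ∀ y, ContinuousOn (w y) (Icc a b))
    (hgx : ∀ s ∈ Ioo a b, Continuous fun y => g y s)
    (hweak : ∀ s ∈ Ioo a b, WeakAt w g r s) (hζ : IsTest r ζ ζ₁ ζ₂)
    (hA : ∀ y, |ζ₁ y| ≤ A) (hB : ∀ y, |ζ₂ y| ≤ B) (hd : 0 < d)
    (hζd : ∀ y, |y - x| ≤ d → ζ₁ y = 0)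
    (hE : ∀ s, HasDerivAt E (E' s) s)
    (hg : ∀ s ∈ Ioo a b, |∫ y, g y s * ζ y * heatKer (b - s + κ) (y - x)| ≤ E' s) :
    |(∫ y, w y b * (ζ y * heatKer κ (y - x))) -
      ∫ y, w y a * (ζ y * heatKer (b - a + κ) (y - x))| ≤
      M * (B + 2 * A / d) * (b - a) + (E b - E a) := by
  rcases hab.eq_or_lt with rfl | hab
  · simp
  obtain ⟨Z, hZ0, hZ⟩ := exists_abs_le_of_zero hζ.cont fun y hy => (hζ.zero y hy).1
  have hM0 : 0 ≤ M := (abs_nonneg _).trans (hM 0 a ⟨le_rfl, hab.le⟩)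
  have hA0 : 0 ≤ A := (abs_nonneg _).trans (hA 0)
  have hζc := hζ.cont
  have hζc1 := hζ.cont₁
  have hζc2 := hζ.cont₂
  set S : ℝ → ℝ := fun τ => ∫ y, w y τ * (ζ y * heatKer (b - τ + κ) (y - x)) with hS
  have hScont : ContinuousOn S (Icc a b) := by
    intro s hs
    refine continuousWithinAt_of_dominated
      (bound := (Ioo (-r) r).indicator fun _ => M * (Z * (√(4 * Real.pi * κ))⁻¹)) ?_ ?_
      (integrable_indicator_Ioo_const _ _) ?_
    · filter_upwards [self_mem_nhdsWithin] with τ hτ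
      have h1 := hwx τ hτ
      have h2 := continuous_heatKer (b - τ + κ)
      exact Continuous.aestronglyMeasurable (by fun_prop)
    · filter_upwards [self_mem_nhdsWithin] with τ hτ
      refine ae_of_all _ (abs_le_indicator_Ioo (fun y _ => ?_) fun y hy => ?_)
      · rw [abs_mul, abs_mul, abs_of_nonneg (heatKer_nonneg _ _)]
        have h1 := hM y τ hτ
        have h2 := hZ y
        have h3 := heatKer_le hκ (show κ ≤ b - τ + κ by linarith [hτ.2]) (y - x)
        have h4 := heatKer_nonneg (b - τ + κ) (y - x)
        gcongr
      · simp [(hζ.zero y hy).1]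
    · refine ae_of_all _ fun y => (hwt y s hs).mul (continuousWithinAt_const.mul ?_)
      have h1 : ContinuousAt (fun τ => heatKer τ (y - x)) (b - s + κ) :=
        (hasDerivAt_heatKer_time (by linarith [hs.2]) _).continuousAt
      exact (ContinuousAt.comp (f := fun s => b - s + κ) h1 (by fun_prop)).continuousWithinAt
  have hderiv : ∀ s ∈ Ioo a b, ∃ D, HasDerivWithinAt S D (Ici s) s ∧
      |D| ≤ M * (B + 2 * A / d) + E' s := by
    intro s hs
    have hsI : s ∈ Icc a b := Ioo_subset_Icc_self hs
    have hθ : 0 < b - s + κ := by linarith [hs.2]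
    have hsub : Ioo s b ⊆ Icc a b := fun τ hτ => ⟨(hs.1.trans hτ.1).le, hτ.2.le⟩
    refine ⟨_, hasDerivWithinAt_integral_mul_moving (w := w) (g := g) (s := s) (b := b) (M := M)
      (Φ := fun τ y => ζ y * heatKer (b - τ + κ) (y - x))
      (Φs := fun y => -(ζ y * (((y - x) ^ 2 / (4 * (b - s + κ) ^ 2) - 1 / (2 * (b - s + κ))) *
        heatKer (b - s + κ) (y - x))))
      (L := Z * (((r + |x|) ^ 2 / (4 * κ ^ 2) + 1 / (2 * κ)) * (√(4 * Real.pi * κ))⁻¹))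
      hs.2 (fun y τ hτ => hM y τ (hsub hτ)) (fun τ hτ => hwx τ (hsub hτ))
      (fun y => ?_) (hweak s hs) (isTest_mul_heatKer hθ hζ) (fun τ hτ => ?_) (fun τ y hy => ?_)
      (fun τ hτ y hy => ?_) (fun y => ?_), ?_⟩
    · have := hwt y s hsI
      refine (this.mono_of_mem_nhdsWithin ?_)
      exact mem_of_superset (Ioo_mem_nhdsGT hs.2) hsub
    · have h2 := continuous_heatKer (b - τ + κ)
      fun_prop
    · simp [(hζ.zero y hy).1]
    · rw [← mul_sub, abs_mul]
      have h1 := abs_heatKer_sub_le (z := y - x) hκ (show κ ≤ b - τ + κ by linarith [hτ.2])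
        (show κ ≤ b - s + κ by linarith [hs.2])
      have h2 : |b - τ + κ - (b - s + κ)| = τ - s := by
        rw [show b - τ + κ - (b - s + κ) = -(τ - s) by ring, abs_neg,
          abs_of_pos (sub_pos.2 hτ.1)]
      rw [h2] at h1
      have h3 : (y - x) ^ 2 ≤ (r + |x|) ^ 2 := by
        rw [← sq_abs (y - x)]
        have := abs_sub y x
        gcongr
        linarith
      have h4 : 0 ≤ τ - s := (sub_pos.2 hτ.1).le
      rw [mul_assoc]
      refine mul_le_mul (hZ y) (h1.trans ?_) (abs_nonneg _) hZ0
      gcongr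
    · have h1 := (hasDerivAt_heatKer_time hθ (y - x)).comp s
        (((hasDerivAt_id s).const_sub b).add_const κ)
      refine (HasDerivAt.congr_deriv (h1.const_mul (ζ y)) ?_).hasDerivWithinAt
      ring
    · set θ := b - s + κ with hθdef
      have hk := continuous_heatKer θ
      have h1 := hwx s hsI
      have h2 := hgx s hs
      have heq : ((∫ y, w y s * -(ζ y * (((y - x) ^ 2 / (4 * θ ^ 2) - 1 / (2 * θ)) *
          heatKer θ (y - x)))) + ∫ y, (w y s * (ζ₂ y * heatKer θ (y - x) +
          2 * ζ₁ y * (-(y - x) / (2 * θ) * heatKer θ (y - x)) +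
          ζ y * (((y - x) ^ 2 / (4 * θ ^ 2) - 1 / (2 * θ)) * heatKer θ (y - x))) +
          g y s * (ζ y * heatKer θ (y - x)))) =
          (∫ y, (w y s * (ζ₂ y + 2 * ζ₁ y * (-(y - x) / (2 * θ)))) * heatKer θ (y - x)) +
          ∫ y, g y s * ζ y * heatKer θ (y - x) := by
        rw [← integral_add, ← integral_add]
        · congr 1 with y
          ring
        · exact integrable_of_zero (r := r) (by fun_prop) fun y hy => by
            simp [(hζ.zero y hy).2.1, (hζ.zero y hy).2.2]
        · exact integrable_of_zero (r := r) (by fun_prop) fun y hy => by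
            simp [(hζ.zero y hy).1]
        · exact integrable_of_zero (r := r) (by fun_prop) fun y hy => by
            simp [(hζ.zero y hy).1]
        · exact integrable_of_zero (r := r) (by fun_prop) fun y hy => by
            simp [(hζ.zero y hy).1, (hζ.zero y hy).2.1, (hζ.zero y hy).2.2]
      rw [heq]
      refine (abs_add_le _ _).trans (add_le_add ?_ (hg s hs))
      refine (abs_integral_mul_heatKer_le hθ (α := M * B) (β := M * (A / (d * θ))) fun y => ?_).trans
        (le_of_eq ?_)
      · rw [abs_mul]
        have h3 : |ζ₂ y + 2 * ζ₁ y * (-(y - x) / (2 * θ))| ≤ B + A / (d * θ) * (y - x) ^ 2 := by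
          refine (abs_add_le _ _).trans (add_le_add (hB y) ?_)
          rcases le_or_gt |y - x| d with h | h
          · rw [hζd y h]
            simp only [mul_zero, zero_mul, abs_zero]
            positivity
          · have h5 : |2 * ζ₁ y * (-(y - x) / (2 * θ))| = |ζ₁ y| * (|y - x| / θ) := by
              rw [abs_mul, abs_mul, abs_div, abs_neg, abs_mul, abs_two, abs_of_pos hθ]
              field_simp
            rw [h5, ← sq_abs (y - x)]
            have h6 : A / (d * θ) * |y - x| ^ 2 = A * (|y - x| / θ * (|y - x| / d)) := by
              field_simp
            rw [h6]
            have h7 : 1 ≤ |y - x| / d := by rw [le_div_iff₀ hd]; linarith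
            refine mul_le_mul (hA y) ?_ (by positivity) hA0
            exact le_mul_of_one_le_right (by positivity) h7
        calc |w y s| * |ζ₂ y + 2 * ζ₁ y * (-(y - x) / (2 * θ))|
            ≤ M * (B + A / (d * θ) * (y - x) ^ 2) :=
              mul_le_mul (hM y s hsI) h3 (abs_nonneg _) hM0
          _ = _ := by ring
      · field_simp
  choose! D hD hDle using hderiv
  have hineq : ∀ a' ∈ Ioo a b, |S b - S a'| ≤ M * (B + 2 * A / d) * (b - a') + (E b - E a') := by
    intro a' ha'
    have hsub : ∀ s ∈ Ico a' b, s ∈ Ioo a b := fun s hs => ⟨ha'.1.trans_le hs.1, hs.2⟩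
    have := image_norm_le_of_norm_deriv_right_le_deriv_boundary (a := a') (b := b)
      (f := fun τ => S τ - S a') (f' := D)
      (B := fun τ => M * (B + 2 * A / d) * (τ - a') + (E τ - E a'))
      (B' := fun τ => M * (B + 2 * A / d) + E' τ)
      ((hScont.mono (Icc_subset_Icc_left ha'.1.le)).sub continuousOn_const)
      (fun s hs => (hD s (hsub s hs)).sub_const _) (by simp)
      (fun s => by
        have h1 := (((hasDerivAt_id s).sub_const a').const_mul (M * (B + 2 * A / d))).add
          ((hE s).sub_const (E a'))
        rw [mul_one] at h1
        exact h1)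
      (fun s hs => hDle s (hsub s hs)) (right_mem_Icc.2 ha'.2.le)
    exact this
  have hSa : Tendsto S (𝓝[>] a) (𝓝 (S a)) :=
    ((hScont a (left_mem_Icc.2 hab.le)).mono_of_mem_nhdsWithin
      (mem_of_superset (Ioo_mem_nhdsGT hab) Ioo_subset_Icc_self)).tendsto
  have hEa : Tendsto E (𝓝[>] a) (𝓝 (E a)) := (hE a).continuousAt.tendsto.mono_left
    nhdsWithin_le_nhds
  have hid : Tendsto (fun t : ℝ => t) (𝓝[>] a) (𝓝 a) := nhdsWithin_le_nhds
  have hlim := le_of_tendsto_of_tendsto ((tendsto_const_nhds (x := S b)).sub hSa).abs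
    ((((tendsto_const_nhds (x := b)).sub hid).const_mul (M * (B + 2 * A / d))).add
      ((tendsto_const_nhds (x := E b)).sub hEa))
    (by filter_upwards [Ioo_mem_nhdsGT hab] with a' ha' using hineq a' ha')
  simpa [hS] using hlim

lemma exists_cutoff {ρ r : ℝ} (hρ : 0 < ρ) (hr : ρ < r) :
    ∃ ζ ζ₁ ζ₂ : ℝ → ℝ, IsTest r ζ ζ₁ ζ₂ ∧ (∀ y, 0 ≤ ζ y) ∧ (∀ y, ζ y ≤ 1) ∧
      ∀ y, |y| ≤ ρ → ζ y = 1 ∧ ζ₁ y = 0 := by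
  let β : ContDiffBump (0 : ℝ) := ⟨ρ, (ρ + r) / 2, hρ, by linarith⟩
  have hβ : ContDiff ℝ 2 β := β.contDiff
  have hβ1 : ContDiff ℝ 1 (deriv β) := (contDiff_succ_iff_deriv.1 hβ).2.2
  have hone : ∀ y, |y| ≤ ρ → β y = 1 := fun y hy =>
    β.one_of_mem_closedBall (by simpa [β] using hy)
  have hnear : ∀ y, r ≤ |y| → (β : ℝ → ℝ) =ᶠ[𝓝 y] fun _ => 0 := by
    intro y hy
    have : ∀ᶠ y' in 𝓝 y, (ρ + r) / 2 < |y'| :=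
      continuousAt_const.eventually_lt continuous_abs.continuousAt (by linarith)
    filter_upwards [this] with y' hy'
    exact β.zero_of_le_dist (by simpa [β] using hy'.le)
  refine ⟨β, deriv β, deriv (deriv β), ⟨fun y => (hβ.differentiable (by simp) y).hasDerivAt,
    fun y => (hβ1.differentiable (by simp) y).hasDerivAt, hβ1.continuous_deriv (by simp),
    fun y hy => ?_⟩, fun y => β.nonneg, fun y => β.le_one, fun y hy => ⟨hone y hy, ?_⟩⟩
  · have h1 := (hnear y hy).deriv
    have h2 := h1.deriv
    refine ⟨(hnear y hy).eq_of_nhds, ?_, ?_⟩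
    · simpa using h1.eq_of_nhds
    · simpa using h2.eq_of_nhds
  · have : IsLocalMax β y := Eventually.of_forall fun y' => by
      rw [hone y hy]; exact β.le_one
    exact this.deriv_eq_zero

lemma abs_second_diff_le {v v₁ v₂ : ℝ → ℝ} (h1 : ∀ y, HasDerivAt v (v₁ y) y)
    (h2 : ∀ y, HasDerivAt v₁ (v₂ y) y) {N x d : ℝ} (hN : ∀ y, |y - x| ≤ d → |v₂ y| ≤ N)
    {z : ℝ} (hz : |z| ≤ d) : |v (x + z) + v (x - z) - 2 * v x| ≤ N * z ^ 2 := by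
  wlog hz0 : 0 ≤ z generalizing z
  · have := this (z := -z) (by rwa [abs_neg]) (by linarith)
    rw [sub_neg_eq_add, ← sub_eq_add_neg, neg_sq] at this
    rwa [add_comm (v (x + z))]
  rw [abs_of_nonneg hz0] at hz
  have hfirst : ∀ s ∈ Icc 0 z, |v₁ (x + s) - v₁ (x - s)| ≤ 2 * N * s := by
    intro s hs
    have := Convex.norm_image_sub_le_of_norm_hasDerivWithin_le (s := Icc (x - s) (x + s))
      (f := v₁) (f' := v₂) (C := N) (x := x - s) (y := x + s)
      (fun y _ => (h2 y).hasDerivWithinAt)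
      (fun y hy => hN y (abs_le.2 ⟨by linarith [hy.1, hs.2], by linarith [hy.2, hs.2]⟩))
      (convex_Icc _ _) ⟨le_rfl, by linarith [hs.1]⟩ ⟨by linarith [hs.1], le_rfl⟩
    rw [Real.norm_eq_abs, Real.norm_eq_abs, show x + s - (x - s) = 2 * s by ring,
      abs_of_nonneg (by linarith [hs.1] : 0 ≤ 2 * s)] at this
    linarith
  have hder : ∀ s, HasDerivAt (fun s => v (x + s) + v (x - s) - 2 * v x)
      (v₁ (x + s) - v₁ (x - s)) s := by
    intro s
    exact ((((h1 (x + s)).comp_const_add x s).add ((h1 (x - s)).comp_const_sub x s)).sub_const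
      (2 * v x)).congr_deriv (by ring)
  have := image_norm_le_of_norm_deriv_right_le_deriv_boundary (a := 0) (b := z)
    (f := fun s => v (x + s) + v (x - s) - 2 * v x) (f' := fun s => v₁ (x + s) - v₁ (x - s))
    (B := fun s => N * s ^ 2) (B' := fun s => 2 * N * s)
    (fun s _ => (hder s).continuousAt.continuousWithinAt)
    (fun s _ => (hder s).hasDerivWithinAt) (by simp; ring)
    (fun s => (((hasDerivAt_id s).pow 2).const_mul N).congr_deriv (by simp; ring))
    (fun s hs => hfirst s (Ico_subset_Icc_self hs)) (right_mem_Icc.2 hz0)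
  exact this

lemma abs_second_deriv_le {v v₁ v₂ : ℝ → ℝ} (h1 : ∀ y, HasDerivAt v (v₁ y) y)
    (h2 : ∀ y, HasDerivAt v₁ (v₂ y) y) (hc : Continuous v₂) {N x d : ℝ} (hd : 0 < d)
    (hN : ∀ z, |z| ≤ d → |v (x + z) + v (x - z) - 2 * v x| ≤ N * z ^ 2) : |v₂ x| ≤ N := by
  refine le_of_forall_pos_le_add fun η hη => ?_
  obtain ⟨δ, hδ, hδv⟩ := Metric.continuousAt_iff.1 (hc.continuousAt (x := x)) η hη
  set z := min d (δ / 2) with hz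
  have hz0 : 0 < z := lt_min hd (half_pos hδ)
  have hzδ : z < δ := (min_le_right _ _).trans_lt (half_lt_self hδ)
  have hq : ∀ y, HasDerivAt (fun y => v y - v₂ x * y ^ 2 / 2) (v₁ y - v₂ x * y) y := fun y =>
    ((h1 y).sub ((((hasDerivAt_id y).pow 2).const_mul (v₂ x)).div_const 2)).congr_deriv
      (by simp; ring)
  have hq' : ∀ y, HasDerivAt (fun y => v₁ y - v₂ x * y) (v₂ y - v₂ x) y := fun y =>
    ((h2 y).sub ((hasDerivAt_id y).const_mul (v₂ x))).congr_deriv (by simp)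
  have h3 := abs_second_diff_le hq hq' (N := η) (x := x) (d := z)
    (fun y hy => (hδv (by rw [Real.dist_eq]; linarith)).le) (z := z) (abs_of_pos hz0).le
  have h4 := hN z (by rw [abs_of_pos hz0]; exact min_le_left _ _)
  have h5 : |v₂ x * z ^ 2| ≤ (N + η) * z ^ 2 := by
    have h6 : v₂ x * z ^ 2 = (v (x + z) + v (x - z) - 2 * v x) -
      (v (x + z) - v₂ x * (x + z) ^ 2 / 2 + (v (x - z) - v₂ x * (x - z) ^ 2 / 2) -
        2 * (v x - v₂ x * x ^ 2 / 2)) := by ring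
    rw [h6]
    refine (abs_sub _ _).trans ?_
    linarith
  rw [abs_mul, abs_of_pos (by positivity : 0 < z ^ 2)] at h5
  exact le_of_mul_le_mul_right h5 (by positivity)

/-- Bounded classical solutions of `u_t = u_xx + f(u)` for positive times, without any joint
regularity assumption. -/
structure IsSol (f : ℝ → ℝ) (M : ℝ) (u : ℝ → ℝ → ℝ) : Prop where
  bd : ∀ x t, |u x t| ≤ M
  c2 : ∀ t, 0 < t → ContDiff ℝ 2 (fun y => u y t)
  pde : ∀ x t, 0 < t →
    HasDerivAt (fun τ => u x τ) (deriv (deriv (fun y => u y t)) x + f (u x t)) t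

section IsSol

variable {f : ℝ → ℝ} {M : ℝ} {u : ℝ → ℝ → ℝ}

lemma IsSol.contDiff_deriv (h : IsSol f M u) {t : ℝ} (ht : 0 < t) :
    ContDiff ℝ 1 (deriv fun y => u y t) :=
  (contDiff_succ_iff_deriv (n := 1).1 (h.c2 t ht)).2.2

lemma IsSol.d1 (h : IsSol f M u) {t : ℝ} (ht : 0 < t) (y : ℝ) :
    HasDerivAt (fun y => u y t) (deriv (fun y => u y t) y) y :=
  ((h.c2 t ht).differentiable (by simp) y).hasDerivAt

lemma IsSol.d2 (h : IsSol f M u) {t : ℝ} (ht : 0 < t) (y : ℝ) :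
    HasDerivAt (deriv fun y => u y t) (deriv (deriv fun y => u y t) y) y :=
  ((h.contDiff_deriv ht).differentiable (by simp) y).hasDerivAt

lemma IsSol.cont (h : IsSol f M u) {t : ℝ} (ht : 0 < t) : Continuous fun y => u y t :=
  (h.c2 t ht).continuous

lemma IsSol.cont₂ (h : IsSol f M u) {t : ℝ} (ht : 0 < t) :
    Continuous (deriv (deriv fun y => u y t)) :=
  (h.contDiff_deriv ht).continuous_deriv (by simp)

lemma IsSol.continuousAt_time (h : IsSol f M u) {t : ℝ} (ht : 0 < t) (x : ℝ) :
    ContinuousAt (u x) t :=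
  (h.pde x t ht).continuousAt

end IsSol

lemma abs_integral_mul_heatKer_sub_le {v : ℝ → ℝ} {M c x β τ : ℝ} (hτ : 0 < τ)
    (hv : Continuous v) (hM : ∀ y, |v y| ≤ M)
    (hβ : ∀ z, |v (x + z) + v (x - z) - 2 * c| ≤ β * z ^ 2) :
    |(∫ y, v y * heatKer τ (y - x)) - c| ≤ β * τ := by
  have hk : Integrable (heatKer τ) := by simpa using integrable_heatKer hτ 0
  have hk1 : ∫ z, heatKer τ z = 1 := by simpa using integral_heatKer hτ 0
  have e1 : ∫ y, v y * heatKer τ (y - x) = ∫ z, v (x + z) * heatKer τ z := by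
    rw [← integral_add_left_eq_self _ x]
    simp
  have e2 : ∫ z, v (x + z) * heatKer τ z = ∫ z, v (x - z) * heatKer τ z := by
    rw [← integral_neg_eq_self]
    simp [heatKer_neg, sub_eq_add_neg]
  have i1 : Integrable fun z => v (x + z) * heatKer τ z :=
    hk.bdd_mul (by fun_prop) (ae_of_all _ fun z => hM _)
  have i2 : Integrable fun z => v (x - z) * heatKer τ z :=
    hk.bdd_mul (by fun_prop) (ae_of_all _ fun z => hM _)
  have e3 : ∫ z, (v (x + z) + v (x - z) - 2 * c) * heatKer τ (z - 0) =
      2 * ((∫ y, v y * heatKer τ (y - x)) - c) := by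
    simp_rw [sub_zero, sub_mul, add_mul]
    have i3 : Integrable fun z => v (x + z) * heatKer τ z + v (x - z) * heatKer τ z := i1.add i2
    rw [integral_sub i3 (hk.const_mul _), integral_add i1 i2, integral_const_mul, hk1,
      ← e2, e1]
    ring
  have h := abs_integral_mul_heatKer_le hτ (x := 0) (α := 0) (β := β)
    (h := fun z => v (x + z) + v (x - z) - 2 * c) (fun z => by simpa using hβ z)
  rw [e3, abs_mul, abs_two] at h
  linarith

/-- Past a time where the second space differences are controlled, a weak solution is Lipschitz
in time, locally uniformly in space. -/
lemma IsSol.exists_lipschitz_after {f : ℝ → ℝ} {M : ℝ} {u : ℝ → ℝ → ℝ} (h : IsSol f M u)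
    (hf : Continuous f) {F : ℝ} (hF : ∀ x t, |f (u x t)| ≤ F) {r' r N : ℝ} (hr' : 0 < r')
    (hr : r' < r) (hN0 : 0 ≤ N) :
    ∃ C, ∀ a t, 0 < a → a ≤ t →
      (∀ s ∈ Ioo a t, WeakAt u (fun y s => f (u y s)) r s) →
      (∀ x z, |x + z| ≤ r → |x - z| ≤ r →
        |u (x + z) a + u (x - z) a - 2 * u x a| ≤ N * z ^ 2) →
      ∀ x, |x| ≤ r' → |u x t - u x a| ≤ C * (t - a) := by
  set d := (r - r') / 2 with hd
  have hd0 : 0 < d := by rw [hd]; linarith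
  obtain ⟨ζ, ζ₁, ζ₂, hζ, hζ0, hζ1, hone⟩ := exists_cutoff (ρ := r' + d) (r := r)
    (by linarith) (by rw [hd]; linarith)
  have hζc := hζ.cont
  obtain ⟨A, hA0, hA⟩ := exists_abs_le_of_zero hζ.cont₁ fun y hy => (hζ.zero y hy).2.1
  obtain ⟨B, hB0, hB⟩ := exists_abs_le_of_zero hζ.cont₂ fun y hy => (hζ.zero y hy).2.2
  have hM0 : 0 ≤ M := (abs_nonneg _).trans (h.bd 0 0)
  have hζu : ∀ y t, |u y t * ζ y| ≤ M := fun y t => by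
    rw [abs_mul, abs_of_nonneg (hζ0 y)]
    exact (mul_le_mul (h.bd y t) (hζ1 y) (hζ0 y) hM0).trans (by simp)
  refine ⟨M * (B + 2 * A / d) + F + (N + 4 * M / d ^ 2), fun a t ha hat hweak hN x hx => ?_⟩
  have ht : 0 < t := ha.trans_le hat
  have hinner : ∀ y, |y - x| ≤ d → |y| ≤ r' + d := fun y hy => by
    have := abs_add_le (y - x) x
    rw [sub_add_cancel] at this
    linarith
  have key : ∀ κ, 0 < κ → |(∫ y, (u y t * ζ y) * heatKer κ (y - x)) - u x a| ≤
      (M * (B + 2 * A / d) + F) * (t - a) + (N + 4 * M / d ^ 2) * (t - a + κ) := by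
    intro κ hκ
    have h1 := heatKer_duality_estimate (w := u) (g := fun y s => f (u y s)) (M := M) (r := r)
      (x := x) (A := A) (B := B) (d := d) (E := fun s => F * s) (E' := fun _ => F)
      hat hκ (fun y s _ => h.bd y s)
      (fun s hs => h.cont (ha.trans_le hs.1))
      (fun y s hs => (h.continuousAt_time (ha.trans_le hs.1) y).continuousWithinAt)
      (fun s hs => hf.comp (h.cont (ha.trans hs.1))) hweak hζ hA hB hd0
      (fun y hy => (hone y (hinner y hy)).2)
      (fun s => by simpa using (hasDerivAt_id s).const_mul F)
      (fun s hs => by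
        have := abs_integral_mul_heatKer_le (show 0 < t - s + κ by linarith [hs.2]) (x := x)
          (α := F) (β := 0) (h := fun y => f (u y s) * ζ y) (fun y => by
            rw [abs_mul, abs_of_nonneg (hζ0 y), zero_mul, add_zero]
            exact (mul_le_mul (hF y s) (hζ1 y) (hζ0 y)
              ((abs_nonneg _).trans (hF y s))).trans (by simp))
        simpa using this)
    have h2 := abs_integral_mul_heatKer_sub_le (v := fun y => u y a * ζ y) (M := M) (c := u x a)
      (x := x) (β := N + 4 * M / d ^ 2) (show 0 < t - a + κ by linarith)
      ((h.cont ha).mul hζ.cont) (fun y => hζu y a) (fun z => ?_)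
    · simp_rw [← mul_assoc] at h1
      have h3 := abs_sub_le (∫ y, (u y t * ζ y) * heatKer κ (y - x))
        (∫ y, (u y a * ζ y) * heatKer (t - a + κ) (y - x)) (u x a)
      linarith
    · rcases le_or_gt |z| d with hz | hz
      · have hp : |x + z| ≤ r' + d := hinner _ (by simpa using hz)
        have hm : |x - z| ≤ r' + d := hinner _ (by simpa using hz)
        have hle : r' + d ≤ r := by rw [hd]; linarith
        simp only [(hone _ hp).1, (hone _ hm).1, mul_one]
        refine (hN x z (hp.trans hle) (hm.trans hle)).trans ?_
        have : 0 ≤ 4 * M / d ^ 2 := by positivity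
        gcongr
        linarith
      · have h4 : |u (x + z) a * ζ (x + z) + u (x - z) a * ζ (x - z) - 2 * u x a| ≤ 4 * M := by
          have e1 := abs_le.1 (hζu (x + z) a)
          have e2 := abs_le.1 (hζu (x - z) a)
          have e3 := abs_le.1 (h.bd x a)
          exact abs_le.2 ⟨by linarith, by linarith⟩
        have h5 : 1 ≤ z ^ 2 / d ^ 2 := by
          rw [le_div_iff₀ (by positivity), one_mul, ← sq_abs z]
          gcongr
        calc _ ≤ 4 * M * 1 := by linarith
          _ ≤ 4 * M * (z ^ 2 / d ^ 2) := by gcongr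
          _ = 0 + 4 * M / d ^ 2 * z ^ 2 := by ring
          _ ≤ N * z ^ 2 + 4 * M / d ^ 2 * z ^ 2 := by gcongr; positivity
          _ = _ := by ring
  have hlimL := ((tendsto_integral_mul_heatKer (v := fun y => u y t * ζ y) (x := x)
    ((h.cont ht).mul hζ.cont) (fun y => hζu y t)).sub_const (u x a)).abs
  have hlimR : Tendsto (fun κ => (M * (B + 2 * A / d) + F) * (t - a) +
      (N + 4 * M / d ^ 2) * (t - a + κ)) (𝓝[>] 0) (𝓝 ((M * (B + 2 * A / d) + F) * (t - a) +
      (N + 4 * M / d ^ 2) * (t - a + 0))) := by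
    refine Tendsto.mono_left (Continuous.tendsto ?_ _) nhdsWithin_le_nhds
    fun_prop
  have hle := le_of_tendsto_of_tendsto hlimL hlimR
    (by filter_upwards [self_mem_nhdsWithin] with κ hκ using key κ hκ)
  rw [(hone x (by linarith)).1, mul_one] at hle
  linarith

/-- A function with bounded derivative on a closed set `T` and with controlled increments across
the gaps of `T` is Lipschitz. -/
lemma abs_sub_le_of_gaps {g : ℝ → ℝ} {T : Set ℝ} {s t C : ℝ} (hst : s ≤ t) (hT : IsClosed T)
    (hs : s ∈ T) (hg : ContinuousOn g (Icc s t))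
    (hD : ∀ τ ∈ T, τ ∈ Icc s t → ∃ D, HasDerivAt g D τ ∧ |D| < C)
    (hgap : ∀ a ∈ T, ∀ b, s ≤ a → a ≤ b → b ≤ t → (∀ τ ∈ Ioo a b, τ ∉ T) →
      |g b - g a| ≤ C * (b - a)) :
    |g t - g s| ≤ C * (t - s) := by
  set G : Set ℝ := T ∩ (Icc s t ∩ (fun τ => |g τ - g s| - C * (τ - s)) ⁻¹' Iic 0) with hG
  have hGc : IsClosed (Icc s t ∩ (fun τ => |g τ - g s| - C * (τ - s)) ⁻¹' Iic 0) := by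
    refine ContinuousOn.preimage_isClosed_of_isClosed ?_ isClosed_Icc isClosed_Iic
    exact (hg.sub continuousOn_const).abs.sub (by fun_prop)
  have hGcomp : IsCompact G :=
    (isCompact_Icc (a := s) (b := t)).of_isClosed_subset (hT.inter hGc) fun x hx => hx.2.1
  have hsG : s ∈ G := ⟨hs, ⟨le_rfl, hst⟩, by simp⟩
  obtain ⟨m, hm, hmax⟩ := hGcomp.exists_isGreatest ⟨s, hsG⟩
  have hmb : |g m - g s| ≤ C * (m - s) := sub_nonpos.1 hm.2.2
  have hmI := hm.2.1
  have step : ∀ b, m ≤ b → |g b - g m| ≤ C * (b - m) → |g b - g s| ≤ C * (b - s) := by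
    intro b _ hb
    have := abs_sub_le (g b) (g m) (g s)
    linarith
  have no : ∀ b ∈ T, m < b → b ≤ t → ¬ |g b - g m| ≤ C * (b - m) := by
    intro b hbT hmb' hbt hb
    have : b ∈ G := ⟨hbT, ⟨hmI.1.trans hmb'.le, hbt⟩, sub_nonpos.2 (step b hmb'.le hb)⟩
    exact absurd (hmax this) (not_le.2 hmb')
  by_cases hne : (T ∩ Ioc m t).Nonempty
  · exfalso
    have hbdd : BddBelow (T ∩ Ioc m t) := ⟨m, fun x hx => hx.2.1.le⟩
    set c := sInf (T ∩ Ioc m t) with hc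
    have hmc : m ≤ c := le_csInf hne fun x hx => hx.2.1.le
    have hcT : c ∈ T := by
      have h1 : c ∈ closure (T ∩ Ioc m t) := csInf_mem_closure hne hbdd
      exact hT.closure_subset (closure_mono inter_subset_left h1)
    have hct : c ≤ t := by
      obtain ⟨y, hy⟩ := hne
      exact (csInf_le hbdd hy).trans hy.2.2
    rcases hmc.eq_or_lt with hmc | hmc
    · obtain ⟨D, hD1, hD2⟩ := hD m hm.1 hmI
      have h1 := (hD1.hasDerivWithinAt (s := Ioi m)).limsup_norm_slope_le hD2
      obtain ⟨e, he, h2⟩ := (mem_nhdsGT_iff_exists_Ioo_subset).1 h1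
      obtain ⟨b, hb, hbe⟩ := exists_lt_of_csInf_lt hne (show c < e by rw [← hmc]; exact he)
      refine no b hb.1 hb.2.1 hb.2.2 ?_
      have h3 := h2 ⟨hb.2.1, hbe⟩
      have hpos : 0 < b - m := sub_pos.2 hb.2.1
      simp only [mem_ofPred_eq, Real.norm_eq_abs, abs_of_pos hpos] at h3
      rw [inv_mul_lt_iff₀ hpos] at h3
      linarith
    · refine no c hcT hmc hct (hgap m hm.1 c hmI.1 hmc.le hct fun τ hτ hτT => ?_)
      exact absurd (csInf_le hbdd ⟨hτT, hτ.1, hτ.2.le.trans hct⟩) (not_le.2 hτ.2)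
  · refine step t hmI.2 (hgap m hm.1 t hmI.1 hmI.2 le_rfl fun τ hτ hτT => ?_)
    exact hne ⟨τ, hτT, hτ.1, hτ.2.le⟩

lemma IsTest.integrable_mul {r : ℝ} {φ φ₁ φ₂ p : ℝ → ℝ} (h : IsTest r φ φ₁ φ₂)
    (hp : Continuous p) : Integrable fun y => p y * φ y :=
  integrable_of_zero (r := r) (hp.mul h.cont) fun y hy => by simp [(h.zero y hy).1]

lemma IsTest.integrable_mul₁ {r : ℝ} {φ φ₁ φ₂ p : ℝ → ℝ} (h : IsTest r φ φ₁ φ₂)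
    (hp : Continuous p) : Integrable fun y => p y * φ₁ y :=
  integrable_of_zero (r := r) (hp.mul h.cont₁) fun y hy => by simp [(h.zero y hy).2.1]

lemma IsTest.integrable_mul₂ {r : ℝ} {φ φ₁ φ₂ p : ℝ → ℝ} (h : IsTest r φ φ₁ φ₂)
    (hp : Continuous p) : Integrable fun y => p y * φ₂ y :=
  integrable_of_zero (r := r) (hp.mul h.cont₂) fun y hy => by simp [(h.zero y hy).2.2]

lemma integral_mul_test_deriv₂ {v v₁ v₂ φ φ₁ φ₂ : ℝ → ℝ} {r : ℝ}
    (h1 : ∀ y, HasDerivAt v (v₁ y) y) (h2 : ∀ y, HasDerivAt v₁ (v₂ y) y) (hc : Continuous v₂)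
    (hφ : IsTest r φ φ₁ φ₂) : ∫ y, v y * φ₂ y = ∫ y, v₂ y * φ y := by
  have c0 : Continuous v := continuous_iff_continuousAt.2 fun y => (h1 y).continuousAt
  have c1 : Continuous v₁ := continuous_iff_continuousAt.2 fun y => (h2 y).continuousAt
  rw [integral_mul_deriv_eq_deriv_mul_of_integrable (fun y _ => h1 y) (fun y _ => hφ.d2 y)
      (hφ.integrable_mul₂ c0)
      (hφ.integrable_mul₁ c1) (hφ.integrable_mul₁ c0),
    integral_mul_deriv_eq_deriv_mul_of_integrable (fun y _ => h2 y) (fun y _ => hφ.d1 y)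
      (hφ.integrable_mul₁ c1)
      (hφ.integrable_mul hc) (hφ.integrable_mul c1), neg_neg]

lemma IsSol.weakAt_of_lipschitz {f : ℝ → ℝ} {M : ℝ} {u : ℝ → ℝ → ℝ} (h : IsSol f M u)
    (hf : Continuous f) {r s β C : ℝ} (hs : 0 < s) (hβ : s < β)
    (hC : ∀ x, |x| < r → ∀ τ ∈ Ioo s β, |u x τ - u x s| ≤ C * (τ - s)) :
    WeakAt u (fun y s => f (u y s)) r s := by
  intro φ φ₁ φ₂ hφ
  obtain ⟨L, hL0, hL⟩ := exists_abs_le_of_zero hφ.cont fun y hy => (hφ.zero y hy).1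
  have hφc := hφ.cont
  have hfu : Continuous fun y => f (u y s) := hf.comp (h.cont hs)
  have hval : ∫ y, (u y s * φ₂ y + f (u y s) * φ y) =
      ∫ y, (deriv (deriv fun y => u y s) y + f (u y s)) * φ y := by
    simp_rw [add_mul]
    rw [integral_add (hφ.integrable_mul₂ (h.cont hs)) (hφ.integrable_mul hfu),
      integral_add (hφ.integrable_mul (h.cont₂ hs)) (hφ.integrable_mul hfu),
      integral_mul_test_deriv₂ (h.d1 hs) (h.d2 hs) (h.cont₂ hs) hφ]
  rw [hval, hasDerivWithinAt_iff_tendsto_slope, Ici_sdiff_left]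
  have hIoo : Ioo s β ∈ 𝓝[>] s := Ioo_mem_nhdsGT hβ
  have hlim : Tendsto (fun τ => ∫ y, slope (u y) s τ * φ y) (𝓝[>] s)
      (𝓝 (∫ y, (deriv (deriv fun y => u y s) y + f (u y s)) * φ y)) := by
    refine tendsto_integral_filter_of_dominated_convergence
      ((Ioo (-r) r).indicator fun _ => C * L) ?_ ?_ (integrable_indicator_Ioo_const _ _) ?_
    · filter_upwards [hIoo] with τ hτ
      have c1 := h.cont hs
      have c2 := h.cont (hs.trans hτ.1)
      simp only [slope_def_field]
      exact Continuous.aestronglyMeasurable (by fun_prop)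
    · filter_upwards [hIoo] with τ hτ
      refine ae_of_all _ (abs_le_indicator_Ioo (fun y hy => ?_) fun y hy => ?_)
      · have hpos : 0 < τ - s := sub_pos.2 hτ.1
        have h1 : |slope (u y) s τ| ≤ C := by
          rw [slope_def_field, abs_div, abs_of_pos hpos, div_le_iff₀ hpos]
          exact hC y hy τ hτ
        rw [abs_mul]
        exact mul_le_mul h1 (hL y) (abs_nonneg _) ((abs_nonneg _).trans h1)
      · simp [(hφ.zero y hy).1]
    · refine ae_of_all _ fun y => Tendsto.mul_const _ ?_
      have h1 := (h.pde y s hs).hasDerivWithinAt (s := Ioi s)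
      rw [hasDerivWithinAt_iff_tendsto_slope' (by simp)] at h1
      exact h1
  refine hlim.congr' ?_
  filter_upwards [hIoo] with τ hτ
  rw [slope_def_field, ← integral_sub (hφ.integrable_mul (h.cont (hs.trans hτ.1)))
    (hφ.integrable_mul (h.cont hs)),
    ← integral_div]
  refine integral_congr_ae (ae_of_all _ fun y => ?_)
  simp only [slope_def_field]
  ring

/-- Times near which the weak formulation on `[-r, r]` fails. -/
def badTimes (w g : ℝ → ℝ → ℝ) (r : ℝ) : Set ℝ :=
  {t | ¬ ∀ᶠ s in 𝓝 t, WeakAt w g r s}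

lemma isClosed_badTimes (w g : ℝ → ℝ → ℝ) (r : ℝ) : IsClosed (badTimes w g r) :=
  isOpen_compl_iff.1 (by simpa [badTimes, compl_ofPred] using isOpen_setOfPred_eventually_nhds)

lemma weakAt_of_notMem_badTimes {w g : ℝ → ℝ → ℝ} {r s : ℝ} (h : s ∉ badTimes w g r) :
    WeakAt w g r s :=
  (not_not.1 h : ∀ᶠ s in 𝓝 s, WeakAt w g r s).self_of_nhds

section Baire

variable {f : ℝ → ℝ} {M : ℝ} {u : ℝ → ℝ → ℝ}

lemma IsSol.exists_second_diff_le (h : IsSol f M u) {t : ℝ} (ht : 0 < t) (r : ℝ) :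
    ∃ N : ℕ, ∀ x z, |x + z| ≤ r → |x - z| ≤ r →
      |u (x + z) t + u (x - z) t - 2 * u x t| ≤ N * z ^ 2 := by
  obtain ⟨B, hB⟩ := (isCompact_Icc (a := -r) (b := r)).exists_bound_of_continuousOn
    (h.cont₂ ht).continuousOn
  obtain ⟨N, hN⟩ := exists_nat_ge B
  refine ⟨N, fun x z hp hm => abs_second_diff_le (h.d1 ht) (h.d2 ht) (d := |z|)
    (fun y hy => (hB y (abs_le.1 ?_)).trans hN) le_rfl⟩
  rw [abs_le] at hp hm hy ⊢
  rcases abs_cases z with hz | hz <;> constructor <;> linarith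

lemma IsSol.exists_portion (h : IsSol f M u) (hf : Continuous f) {F : ℝ}
    (hF : ∀ x t, |f (u x t)| ≤ F) {r t₀ : ℝ} (ht₀ : 0 < t₀)
    (hbad : t₀ ∈ badTimes u (fun y s => f (u y s)) r) :
    ∃ p q : ℚ, (∃ τ ∈ badTimes u (fun y s => f (u y s)) r, (p : ℝ) < τ ∧ τ < q) ∧
      ∀ r', 0 < r' → r' < r → ∀ s, (p : ℝ) < s → s < q → WeakAt u (fun y s => f (u y s)) r' s := by
  set Z := badTimes u (fun y s => f (u y s)) r with hZ
  have hZc : IsClosed Z := isClosed_badTimes _ _ _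
  set Y : Set ℝ := Z ∩ Ioi 0 with hY
  have : LocallyCompactSpace Y :=
    (hZc.isLocallyClosed.inter isOpen_Ioi.isLocallyClosed).locallyCompactSpace
  have : Nonempty Y := ⟨⟨t₀, hbad, ht₀⟩⟩
  obtain ⟨N, ⟨σ, hσ⟩⟩ := nonempty_interior_of_iUnion_of_closed (X := Y)
    (f := fun N : ℕ => {t : Y | ∀ x z, |x + z| ≤ r → |x - z| ≤ r →
      |u (x + z) t + u (x - z) t - 2 * u x t| ≤ N * z ^ 2}) (fun N => by
      have hc : ∀ x, Continuous fun t : Y => u x t := fun x =>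
        continuous_iff_continuousAt.2 fun t =>
          (h.continuousAt_time t.2.2 x).comp continuous_subtype_val.continuousAt
      simp only [ofPred_forall]
      refine isClosed_iInter fun x => isClosed_iInter fun z => isClosed_iInter fun _ =>
        isClosed_iInter fun _ => isClosed_le ?_ continuous_const
      exact (((hc _).add (hc _)).sub (continuous_const.mul (hc _))).abs)
    (eq_univ_of_forall fun t => mem_iUnion.2 (h.exists_second_diff_le t.2.2 r))
  rw [mem_interior_iff_mem_nhds, mem_nhds_subtype] at hσ
  obtain ⟨V, hV, hVN⟩ := hσ
  obtain ⟨l, b, hlb, hlV⟩ := mem_nhds_iff_exists_Ioo_subset.1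
    (inter_mem hV (isOpen_Ioi.mem_nhds σ.2.2))
  obtain ⟨p, hp1, hp2⟩ := exists_rat_btwn (max_lt hlb.1 σ.2.2)
  obtain ⟨q, hq1, hq2⟩ := exists_rat_btwn hlb.2
  have hp0 : (0 : ℝ) < p := (le_max_right _ _).trans_lt hp1
  refine ⟨p, q, ⟨σ, σ.2.1, hp2, hq1⟩, fun r' hr' hrr s hs1 hs2 => ?_⟩
  have hN : ∀ t ∈ Z, (p : ℝ) < t → t < q → ∀ x z, |x + z| ≤ r → |x - z| ≤ r →
      |u (x + z) t + u (x - z) t - 2 * u x t| ≤ N * z ^ 2 := fun t htZ hpt htq =>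
    hVN (a := ⟨t, htZ, hp0.trans hpt⟩)
      (hlV ⟨(le_max_left _ _).trans_lt (hp1.trans hpt), htq.trans hq2⟩).1
  by_cases hsZ : s ∈ Z
  · obtain ⟨C, hC⟩ := h.exists_lipschitz_after hf hF hr' hrr N.cast_nonneg
    have hs0 := hp0.trans hs1
    refine h.weakAt_of_lipschitz hf hs0 hs2 (C := max C (N + F + 1)) fun x hx τ hτ => ?_
    refine abs_sub_le_of_gaps hτ.1.le hZc hsZ (fun t ht =>
      (h.continuousAt_time (hs0.trans_le ht.1) x).continuousWithinAt) (fun t htZ ht => ?_)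
      fun a haZ b hsa hab hbt hgap => ?_
    · refine ⟨_, h.pde x t (hs0.trans_le ht.1), lt_max_of_lt_right ?_⟩
      have ht0 := hs0.trans_le ht.1
      have h1 := abs_second_deriv_le (h.d1 ht0) (h.d2 ht0) (h.cont₂ ht0) (N := N) (x := x)
        (d := r - r') (by linarith) fun z hz =>
          hN t htZ (hs1.trans_le ht.1) (ht.2.trans_lt hτ.2) x z
            ((abs_add_le _ _).trans (by linarith)) ((abs_sub _ _).trans (by linarith))
      have h2 := abs_add_le (deriv (deriv fun y => u y t) x) (f (u x t))
      have h3 := hF x t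
      linarith
    · refine (hC a b (hs0.trans_le hsa) hab
        (fun σ hσ => weakAt_of_notMem_badTimes (hgap σ hσ))
        (hN a haZ (hs1.trans_le hsa) ((hab.trans hbt).trans_lt hτ.2)) x hx.le).trans ?_
      gcongr
      exact le_max_left _ _
  · exact (weakAt_of_notMem_badTimes hsZ).mono hrr.le

lemma IsSol.weakAt (h : IsSol f M u) (hf : Continuous f) {F : ℝ}
    (hF : ∀ x t, |f (u x t)| ≤ F) (r : ℝ) {s : ℝ} (hs : 0 < s) :
    WeakAt u (fun y s => f (u y s)) r s := by
  by_contra hcon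
  have hbad : ∀ r' ∈ Ioo (max r 0) (max r 0 + 1), s ∈ badTimes u (fun y s => f (u y s)) r' :=
    fun r' hr' => by
      by_contra hc
      exact hcon ((weakAt_of_notMem_badTimes hc).mono ((le_max_left _ _).trans hr'.1.le))
  choose! p q hτ hweak using fun r' hr' => h.exists_portion hf hF hs (hbad r' hr')
  have hlt : ∀ a ∈ Ioo (max r 0) (max r 0 + 1), ∀ b ∈ Ioo (max r 0) (max r 0 + 1), a < b →
      (p a, q a) ≠ (p b, q b) := by
    intro a ha b hb hab heq
    obtain ⟨τ, hτZ, hτp, hτq⟩ := hτ a ha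
    rw [Prod.mk.injEq] at heq
    rw [heq.1] at hτp
    rw [heq.2] at hτq
    refine hτZ ?_
    filter_upwards [isOpen_Ioo.mem_nhds (show τ ∈ Ioo (p b : ℝ) (q b) from ⟨hτp, hτq⟩)] with σ hσ
    exact hweak b hb a ((le_max_right _ _).trans_lt ha.1) hab σ hσ.1 hσ.2
  have hinj : InjOn (fun a => (p a, q a)) (Ioo (max r 0) (max r 0 + 1)) := by
    intro a ha b hb heq
    rcases lt_trichotomy a b with hab | hab | hab
    · exact absurd heq (hlt a ha b hb hab)
    · exact hab
    · exact absurd heq.symm (hlt b hb a ha hab)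
  exact Cardinal.Real.Ioo_countable_iff.not.2 (not_le.2 (lt_add_one _))
    ((mapsTo_univ _ _).countable_of_injOn hinj countable_univ)

end Baire

lemma IsTest.comp_affine {r : ℝ} {φ φ₁ φ₂ : ℝ → ℝ} (h : IsTest r φ φ₁ φ₂) (x : ℝ) {R : ℝ}
    (hR : 0 < R) :
    IsTest (|x| + r * R) (fun y => φ ((y - x) / R)) (fun y => φ₁ ((y - x) / R) / R)
      (fun y => φ₂ ((y - x) / R) / R ^ 2) := by
  have hl : ∀ y, HasDerivAt (fun y => (y - x) / R) (1 / R) y := fun y =>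
    ((hasDerivAt_id y).sub_const x).div_const R
  have h₂ := h.cont₂
  refine ⟨fun y => ((h.d1 _).comp y (hl y)).congr_deriv (by ring),
    fun y => (((h.d2 _).comp y (hl y)).div_const R).congr_deriv (by ring), by fun_prop, ?_⟩
  intro y hy
  have h1 : r ≤ |(y - x) / R| := by
    rw [abs_div, abs_of_pos hR, le_div_iff₀ hR]
    linarith [abs_sub_abs_le_abs_sub y x]
  obtain ⟨h2, h3, h4⟩ := h.zero _ h1
  simp [h2, h3, h4]

lemma WeakAt.translate {w g : ℝ → ℝ → ℝ} {r s : ℝ} (c : ℝ) (h : WeakAt w g (|c| + r) s) :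
    WeakAt (fun y s => w (y + c) s) (fun y s => g (y + c) s) r s := by
  intro φ φ₁ φ₂ hφ
  have hφc : IsTest (|c| + r) (fun y => φ (y - c)) (fun y => φ₁ (y - c)) (fun y => φ₂ (y - c)) := by
    simpa using hφ.comp_affine c one_pos
  have h1 := h _ _ _ hφc
  have e1 : ∀ τ, ∫ y, w y τ * φ (y - c) = ∫ y, w (y + c) τ * φ y := fun τ => by
    rw [← integral_add_right_eq_self _ c]
    simp
  have e2 : ∫ y, (w y s * φ₂ (y - c) + g y s * φ (y - c)) =
      ∫ y, (w (y + c) s * φ₂ y + g (y + c) s * φ y) := by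
    rw [← integral_add_right_eq_self _ c]
    simp
  simpa only [e1, e2] using h1

lemma WeakAt.sub {w w' g g' : ℝ → ℝ → ℝ} {r s : ℝ} (h : WeakAt w g r s) (h' : WeakAt w' g' r s)
    (hw : ∀ τ, s ≤ τ → Continuous fun y => w y τ) (hw' : ∀ τ, s ≤ τ → Continuous fun y => w' y τ)
    (hg : Continuous fun y => g y s) (hg' : Continuous fun y => g' y s) :
    WeakAt (fun y s => w y s - w' y s) (fun y s => g y s - g' y s) r s := by
  intro φ φ₁ φ₂ hφ
  have e1 : ∀ τ ∈ Ici s, ∫ y, (w y τ - w' y τ) * φ y =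
      (∫ y, w y τ * φ y) - ∫ y, w' y τ * φ y := fun τ hτ => by
    simp_rw [sub_mul]
    exact integral_sub (hφ.integrable_mul (hw τ hτ)) (hφ.integrable_mul (hw' τ hτ))
  have i1 : Integrable fun y => w y s * φ₂ y + g y s * φ y :=
    (hφ.integrable_mul₂ (hw s le_rfl)).add (hφ.integrable_mul hg)
  have i2 : Integrable fun y => w' y s * φ₂ y + g' y s * φ y :=
    (hφ.integrable_mul₂ (hw' s le_rfl)).add (hφ.integrable_mul hg')
  refine (((h φ φ₁ φ₂ hφ).sub (h' φ φ₁ φ₂ hφ)).congr e1 (e1 s self_mem_Ici)).congr_deriv ?_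
  rw [← integral_sub i1 i2]
  congr 1 with y
  ring

lemma abs_integral_mul_heatKer_le_exp {τ : ℝ} (hτ : 0 < τ) {x α β : ℝ} {h : ℝ → ℝ}
    (hh : ∀ y, |h y| ≤ α + β * Real.exp (-y)) :
    |∫ y, h y * heatKer τ (y - x)| ≤ α + β * Real.exp (-x + τ) := by
  have i1 := (integrable_heatKer hτ x).const_mul α
  have i2 := (integrable_exp_neg_mul_heatKer hτ x).const_mul β
  have e : ∫ y, (α * heatKer τ (y - x) + β * (Real.exp (-y) * heatKer τ (y - x))) =
      α + β * Real.exp (-x + τ) := by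
    rw [integral_add i1 i2, integral_const_mul, integral_const_mul, integral_heatKer hτ,
      integral_exp_neg_mul_heatKer hτ, mul_one]
  rw [← e, ← Real.norm_eq_abs]
  refine norm_integral_le_of_norm_le (i1.add i2) (ae_of_all _ fun y => ?_)
  rw [Real.norm_eq_abs, abs_mul, abs_of_nonneg (heatKer_nonneg _ _)]
  calc _ ≤ (α + β * Real.exp (-y)) * heatKer τ (y - x) :=
        mul_le_mul_of_nonneg_right (hh y) (heatKer_nonneg _ _)
    _ = _ := by ring

/-- Bounded weak solutions of `w_t = w_yy + f(w)` on `[0, ∞)`. -/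
structure IsWeakSol (f : ℝ → ℝ) (M : ℝ) (w : ℝ → ℝ → ℝ) : Prop where
  bd : ∀ y t, |w y t| ≤ M
  cx : ∀ t, 0 ≤ t → Continuous fun y => w y t
  ct : ∀ y, ContinuousOn (w y) (Ici 0)
  weak : ∀ r s, 0 < s → WeakAt w (fun y s => f (w y s)) r s

lemma IsSol.isWeakSol {f : ℝ → ℝ} {M : ℝ} {u : ℝ → ℝ → ℝ} (h : IsSol f M u)
    (hf : Continuous f) {F : ℝ} (hF : ∀ x t, |f (u x t)| ≤ F) {u₀ : ℝ → ℝ} (hu₀ : Continuous u₀)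
    (hinit : ∀ x, Tendsto (u x) (𝓝[>] 0) (𝓝 (u₀ x))) :
    IsWeakSol f M fun x t => if t ≤ 0 then u₀ x else u x t := by
  refine ⟨fun y t => ?_, fun t ht => ?_, fun y t ht => ?_, fun r s hs φ φ₁ φ₂ hφ => ?_⟩
  · split_ifs with htc
    · exact le_of_tendsto (hinit y).abs (Eventually.of_forall fun t => h.bd y t)
    · exact h.bd y t
  · split_ifs with htc
    · exact hu₀
    · exact h.cont (not_le.1 htc)
  · rcases (show (0 : ℝ) ≤ t from ht).eq_or_lt with rfl | ht0
    · rw [← continuousWithinAt_Ioi_iff_Ici, ContinuousWithinAt, if_pos le_rfl]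
      refine (hinit y).congr' ?_
      filter_upwards [self_mem_nhdsWithin] with τ hτ
      rw [if_neg (not_le.2 hτ)]
    · refine ((h.continuousAt_time ht0 y).congr ?_).continuousWithinAt
      filter_upwards [lt_mem_nhds ht0] with τ hτ
      rw [if_neg (not_le.2 hτ)]
  · have := (h.weakAt hf hF r hs φ φ₁ φ₂ hφ).congr
      (f₁ := fun τ => ∫ y, (if τ ≤ 0 then u₀ y else u y τ) * φ y)
      (fun τ hτ => by simp only [if_neg (not_le.2 (hs.trans_le hτ))])
      (by simp only [if_neg (not_le.2 hs)])
    simpa only [if_neg (not_le.2 hs)] using this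

section Limit

variable {f : ℝ → ℝ} {M : ℝ} {w : ℝ → ℝ → ℝ} {K : NNReal}

/-- One Picard-type improvement of an exponential bound on a space increment. -/
lemma IsWeakSol.increment_bound_improve (h : IsWeakSol f M w) (hf : LipschitzWith K f)
    {c ε C η : ℝ} (hη : 0 ≤ η)
    (h0 : ∀ y, |w (y + c) 0 - w y 0| ≤ ε + C * Real.exp (-y))
    (hP : ∀ y s, 0 ≤ s → |w (y + c) s - w y s| ≤
      (ε + C * Real.exp (-y + s)) * Real.exp (K * s) + η * Real.exp (2 * K * s))
    {x t : ℝ} (ht : 0 ≤ t) :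
    |w (x + c) t - w x t| ≤
      (ε + C * Real.exp (-x + t)) * Real.exp (K * t) + η / 2 * Real.exp (2 * K * t) := by
  obtain ⟨ζ, ζ₁, ζ₂, hζ, hζ0, hζ1, hone⟩ := exists_cutoff (ρ := 1) (r := 2) one_pos one_lt_two
  obtain ⟨A, hA0, hA⟩ := exists_abs_le_of_zero hζ.cont₁ fun y hy => (hζ.zero y hy).2.1
  obtain ⟨B, hB0, hB⟩ := exists_abs_le_of_zero hζ.cont₂ fun y hy => (hζ.zero y hy).2.2
  have hζc := hζ.cont
  have cut : ∀ (a : ℝ) (z : ℝ) {b : ℝ}, |a| ≤ b → |a * ζ z| ≤ b := fun a z b hab => by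
    rw [abs_mul, abs_of_nonneg (hζ0 z)]
    exact (mul_le_of_le_one_right (abs_nonneg a) (hζ1 z)).trans hab
  have hvc : ∀ s, 0 ≤ s → Continuous fun y => w (y + c) s - w y s := fun s hs =>
    ((h.cx s hs).comp (continuous_add_const c)).sub (h.cx s hs)
  have hv2 : ∀ y s, |w (y + c) s - w y s| ≤ 2 * M := fun y s => by
    have h1 := abs_sub (w (y + c) s) (w y s)
    linarith [h.bd (y + c) s, h.bd y s]
  have key : ∀ R, 0 < R → ∀ κ, 0 < κ →
      |∫ y, (w (y + c) t - w y t) * ζ ((y - x) / R) * heatKer κ (y - x)| ≤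
      (ε + C * Real.exp (-x + (t + κ))) * Real.exp (K * t) + η / 2 * Real.exp (2 * K * t) +
        2 * M * (B + 2 * A) * t / R ^ 2 := by
    intro R hR κ hκ
    have h1 := heatKer_duality_estimate (w := fun y s => w (y + c) s - w y s)
      (g := fun y s => f (w (y + c) s) - f (w y s)) (M := 2 * M) (r := |x| + 2 * R) (x := x)
      (A := A / R) (B := B / R ^ 2) (d := R)
      (E := fun s => (ε + C * Real.exp (-x + (t + κ))) * Real.exp (K * s) +
        η / 2 * Real.exp (2 * K * s))
      (E' := fun s => K * ((ε + C * Real.exp (-x + (t + κ))) * Real.exp (K * s) +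
        η * Real.exp (2 * K * s)))
      ht hκ (fun y s _ => hv2 y s) (fun s hs => hvc s hs.1)
      (fun y => ((h.ct (y + c)).sub (h.ct y)).mono Icc_subset_Ici_self)
      (fun s hs => (hf.continuous.comp ((h.cx s hs.1.le).comp (continuous_add_const c))).sub
        (hf.continuous.comp (h.cx s hs.1.le)))
      (fun s hs => ((h.weak _ s hs.1).translate c).sub (h.weak _ s hs.1)
        (fun τ hτ => (h.cx τ (hs.1.le.trans hτ)).comp (continuous_add_const c))
        (fun τ hτ => h.cx τ (hs.1.le.trans hτ))
        (hf.continuous.comp ((h.cx s hs.1.le).comp (continuous_add_const c)))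
        (hf.continuous.comp (h.cx s hs.1.le)))
      (hζ.comp_affine x hR)
      (fun y => by rw [abs_div, abs_of_pos hR]; exact div_le_div_of_nonneg_right (hA _) hR.le)
      (fun y => by
        rw [abs_div, abs_of_pos (pow_pos hR 2)]
        exact div_le_div_of_nonneg_right (hB _) (by positivity))
      hR
      (fun y hy => by
        have : |(y - x) / R| ≤ 1 := by rwa [abs_div, abs_of_pos hR, div_le_one hR]
        simp [(hone _ this).2])
      (fun s => by
        have e1 : HasDerivAt (fun s : ℝ => Real.exp (K * s)) (Real.exp (K * s) * K) s := by
          simpa using ((hasDerivAt_id s).const_mul (K : ℝ)).exp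
        have e2 : HasDerivAt (fun s : ℝ => Real.exp (2 * K * s))
            (Real.exp (2 * K * s) * (2 * K)) s := by
          simpa using ((hasDerivAt_id s).const_mul (2 * K : ℝ)).exp
        exact ((e1.const_mul _).add (e2.const_mul _)).congr_deriv (by ring))
      (fun s hs => by
        have h2 := abs_integral_mul_heatKer_le_exp (show 0 < t - s + κ by linarith [hs.2])
          (x := x) (α := K * (ε * Real.exp (K * s) + η * Real.exp (2 * K * s)))
          (β := K * (C * Real.exp s * Real.exp (K * s)))
          (h := fun y => (f (w (y + c) s) - f (w y s)) * ζ ((y - x) / R)) (fun y => by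
            refine cut _ _ ?_
            have h3 := hf.dist_le_mul (w (y + c) s) (w y s)
            rw [Real.dist_eq, Real.dist_eq] at h3
            refine h3.trans ((mul_le_mul_of_nonneg_left (hP y s hs.1.le) K.coe_nonneg).trans_eq ?_)
            rw [Real.exp_add]
            ring)
        refine h2.trans_eq ?_
        have h3 : Real.exp (-x + (t + κ)) = Real.exp s * Real.exp (-x + (t - s + κ)) := by
          rw [← Real.exp_add]
          ring_nf
        rw [h3]
        ring)
    have h2 := abs_integral_mul_heatKer_le_exp (show 0 < t - 0 + κ by linarith)
      (x := x) (α := ε) (β := C) (h := fun y => (w (y + c) 0 - w y 0) * ζ ((y - x) / R))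
      (fun y => cut _ _ (h0 y))
    simp only [← mul_assoc, mul_zero, Real.exp_zero, mul_one, sub_zero] at h1 h2
    have h3 := abs_sub_abs_le_abs_sub
      (∫ y, (w (y + c) t - w y t) * ζ ((y - x) / R) * heatKer κ (y - x))
      (∫ y, (w (y + c) 0 - w y 0) * ζ ((y - x) / R) * heatKer (t + κ) (y - x))
    have h4 : 2 * M * (B / R ^ 2 + 2 * (A / R) / R) * t = 2 * M * (B + 2 * A) * t / R ^ 2 := by
      field_simp
    linarith
  have keyR : ∀ R, 0 < R → |w (x + c) t - w x t| ≤
      (ε + C * Real.exp (-x + (t + 0))) * Real.exp (K * t) + η / 2 * Real.exp (2 * K * t) +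
        2 * M * (B + 2 * A) * t / R ^ 2 := by
    intro R hR
    have hvt := hvc t ht
    have hL := (tendsto_integral_mul_heatKer (x := x) (M := 2 * M)
      (v := fun y => (w (y + c) t - w y t) * ζ ((y - x) / R)) (by fun_prop)
      (fun y => cut _ _ (hv2 y t))).abs
    have hRt : Tendsto (fun κ => (ε + C * Real.exp (-x + (t + κ))) * Real.exp (K * t) +
        η / 2 * Real.exp (2 * K * t) + 2 * M * (B + 2 * A) * t / R ^ 2) (𝓝[>] 0)
        (𝓝 ((ε + C * Real.exp (-x + (t + 0))) * Real.exp (K * t) +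
        η / 2 * Real.exp (2 * K * t) + 2 * M * (B + 2 * A) * t / R ^ 2)) :=
      Tendsto.mono_left (Continuous.tendsto (by fun_prop) _) nhdsWithin_le_nhds
    have := le_of_tendsto_of_tendsto hL hRt
      (by filter_upwards [self_mem_nhdsWithin] with κ hκ using key R hR κ hκ)
    simpa [(hone 0 (by simp)).1] using this
  have hlim : Tendsto (fun R : ℝ => (ε + C * Real.exp (-x + (t + 0))) * Real.exp (K * t) +
      η / 2 * Real.exp (2 * K * t) + 2 * M * (B + 2 * A) * t / R ^ 2) atTop
      (𝓝 ((ε + C * Real.exp (-x + (t + 0))) * Real.exp (K * t) +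
        η / 2 * Real.exp (2 * K * t) + 0)) :=
    tendsto_const_nhds.add (tendsto_const_nhds.div_atTop (tendsto_pow_atTop two_ne_zero))
  have := ge_of_tendsto hlim (by filter_upwards [eventually_gt_atTop 0] with R hR using keyR R hR)
  simpa using this

lemma IsWeakSol.increment_bound (h : IsWeakSol f M w) (hf : LipschitzWith K f)
    {c ε C : ℝ} (hε : 0 ≤ ε) (hC : 0 ≤ C)
    (h0 : ∀ y, |w (y + c) 0 - w y 0| ≤ ε + C * Real.exp (-y)) {x t : ℝ} (ht : 0 ≤ t) :
    |w (x + c) t - w x t| ≤ (ε + C * Real.exp (-x + t)) * Real.exp (K * t) := by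
  have hM0 : 0 ≤ M := (abs_nonneg _).trans (h.bd 0 0)
  have hn : ∀ n : ℕ, ∀ y s, 0 ≤ s → |w (y + c) s - w y s| ≤
      (ε + C * Real.exp (-y + s)) * Real.exp (K * s) +
        2 * M * (1 / 2) ^ n * Real.exp (2 * K * s) := by
    intro n
    induction n with
    | zero =>
      intro y s hs
      have h1 := abs_sub (w (y + c) s) (w y s)
      have h2 : 2 * M * 1 ≤ 2 * M * Real.exp (2 * K * s) :=
        mul_le_mul_of_nonneg_left (Real.one_le_exp (by positivity)) (by positivity)
      have h3 : 0 ≤ (ε + C * Real.exp (-y + s)) * Real.exp (K * s) := by positivity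
      rw [pow_zero, mul_one]
      linarith [h.bd (y + c) s, h.bd y s]
    | succ n ih =>
      intro y s hs
      refine (h.increment_bound_improve hf (by positivity) h0 ih hs).trans_eq ?_
      ring
  have hlim : Tendsto (fun n : ℕ => (ε + C * Real.exp (-x + t)) * Real.exp (K * t) +
      2 * M * (1 / 2) ^ n * Real.exp (2 * K * t)) atTop
      (𝓝 ((ε + C * Real.exp (-x + t)) * Real.exp (K * t) +
        2 * M * 0 * Real.exp (2 * K * t))) :=
    tendsto_const_nhds.add (((tendsto_pow_atTop_nhds_zero_of_lt_one (by norm_num)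
      (by norm_num)).const_mul _).mul_const _)
  have := ge_of_tendsto' hlim fun n => hn n x t ht
  simpa using this

lemma IsWeakSol.exists_tendsto_atTop (h : IsWeakSol f M w) (hf : LipschitzWith K f) {θ : ℝ}
    (hθ : Tendsto (fun y => w y 0) atTop (𝓝 θ)) {t : ℝ} (ht : 0 ≤ t) :
    ∃ l, Tendsto (fun y => w y t) atTop (𝓝 l) := by
  refine cauchySeq_tendsto_of_complete (Metric.cauchySeq_iff'.2 fun δ hδ => ?_)
  have hM0 : 0 ≤ M := (abs_nonneg _).trans (h.bd 0 0)
  set ε := δ / 2 * Real.exp (-(K * t)) with hε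
  have hε0 : 0 < ε := by positivity
  obtain ⟨Y, hY⟩ := (Metric.tendsto_atTop.1 hθ) (ε / 2) (by positivity)
  have hinit : ∀ c, 0 ≤ c → ∀ y, |w (y + c) 0 - w y 0| ≤
      ε + 2 * M * Real.exp Y * Real.exp (-y) := by
    intro c hc y
    rcases le_or_gt Y y with hy | hy
    · have h1 := hY y hy
      have h2 := hY (y + c) (by linarith)
      have h3 := dist_triangle_right (w (y + c) 0) (w y 0) θ
      rw [Real.dist_eq (w (y + c) 0) (w y 0)] at h3
      have : 0 ≤ 2 * M * Real.exp Y * Real.exp (-y) := by positivity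
      linarith
    · have h1 := abs_sub (w (y + c) 0) (w y 0)
      have h2 : 2 * M * 1 ≤ 2 * M * Real.exp (Y + -y) :=
        mul_le_mul_of_nonneg_left (Real.one_le_exp (by linarith)) (by positivity)
      rw [Real.exp_add, ← mul_assoc] at h2
      linarith [h.bd (y + c) 0, h.bd y 0]
  have hlim : Tendsto (fun x => (ε + 2 * M * Real.exp Y * Real.exp (-x + t)) * Real.exp (K * t))
      atTop (𝓝 ((ε + 2 * M * Real.exp Y * 0) * Real.exp (K * t))) := by
    refine ((tendsto_const_nhds.add (Tendsto.const_mul _ ?_)).mul_const _)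
    exact Real.tendsto_exp_atBot.comp
      (tendsto_atBot_add_const_right _ _ tendsto_neg_atTop_atBot)
  have hval : (ε + 2 * M * Real.exp Y * 0) * Real.exp (K * t) < δ := by
    rw [mul_zero, add_zero, hε, mul_assoc, ← Real.exp_add, neg_add_cancel, Real.exp_zero]
    linarith
  obtain ⟨X, hX⟩ := (hlim.eventually (gt_mem_nhds hval)).exists
  refine ⟨X, fun y hy => ?_⟩
  have := h.increment_bound hf hε0.le (by positivity) (hinit (y - X) (sub_nonneg.2 hy))
    (x := X) ht
  rw [add_sub_cancel] at this
  exact this.trans_lt hX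

end Limit

lemma exists_normalized_test : ∃ φ φ₁ φ₂, IsTest 2 φ φ₁ φ₂ ∧ ∫ y, φ y = 1 := by
  obtain ⟨ζ, ζ₁, ζ₂, hζ, hζ0, -, hone⟩ := exists_cutoff (ρ := 1) (r := 2) one_pos one_lt_two
  have hpos : 0 < ∫ y, ζ y :=
    hζ.cont.integral_pos_of_hasCompactSupport_nonneg_nonzero
      (hasCompactSupport_of_zero fun y hy => (hζ.zero y hy).1) hζ0 (x := 0)
      (by simp [(hone 0 (by simp)).1])
  refine ⟨fun y => ζ y / ∫ y, ζ y, fun y => ζ₁ y / ∫ y, ζ y, fun y => ζ₂ y / ∫ y, ζ y,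
    ⟨fun y => (hζ.d1 y).div_const _, fun y => (hζ.d2 y).div_const _, hζ.cont₂.div_const _,
      fun y hy => by simp [hζ.zero y hy]⟩, ?_⟩
  rw [integral_div, div_self hpos.ne']

lemma IsTest.integral_deriv₂ {r : ℝ} {φ φ₁ φ₂ : ℝ → ℝ} (h : IsTest r φ φ₁ φ₂) :
    ∫ y, φ₂ y = 0 := by
  simpa using integral_mul_test_deriv₂ (v := fun _ => 1) (v₁ := fun _ => 0) (v₂ := fun _ => 0)
    (fun y => hasDerivAt_const y _) (fun y => hasDerivAt_const y _) continuous_const h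

section Limit

variable {f : ℝ → ℝ} {M : ℝ} {w : ℝ → ℝ → ℝ}

lemma IsWeakSol.limit_integral_eq (h : IsWeakSol f M w) (hf : Continuous f) {F : ℝ}
    (hF : ∀ x t, |f (w x t)| ≤ F) {Θ : ℝ → ℝ}
    (hΘ : ∀ t, 0 ≤ t → Tendsto (fun y => w y t) atTop (𝓝 (Θ t))) {s t : ℝ} (hs : 0 ≤ s)
    (hst : s ≤ t) : ∫ σ in s..t, f (Θ σ) = Θ t - Θ s := by
  obtain ⟨φ, φ₁, φ₂, hφ, hφ1⟩ := exists_normalized_test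
  have hφc := hφ.cont
  have hφc₂ := hφ.cont₂
  have iφ : Integrable φ := integrable_of_zero hφc fun y hy => (hφ.zero y hy).1
  have iφ₂ : Integrable φ₂ := integrable_of_zero hφc₂ fun y hy => (hφ.zero y hy).2.2
  set b : ℝ → ℝ := fun y => M * |φ₂ y| + F * |φ y| with hb
  have ib : Integrable b := (iφ₂.abs.const_mul M).add (iφ.abs.const_mul F)
  have hbound : ∀ y z σ, |w z σ * φ₂ y + f (w z σ) * φ y| ≤ b y := fun y z σ => by
    refine (abs_add_le _ _).trans ?_
    rw [abs_mul, abs_mul]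
    exact add_le_add (mul_le_mul_of_nonneg_right (h.bd z σ) (abs_nonneg _))
      (mul_le_mul_of_nonneg_right (hF z σ) (abs_nonneg _))
  have hmeas : ∀ σ, 0 ≤ σ → ∀ x, AEStronglyMeasurable
      (fun y => w (y + x) σ * φ₂ y + f (w (y + x) σ) * φ y) volume := fun σ hσ x => by
    have := h.cx σ hσ
    exact Continuous.aestronglyMeasurable (by fun_prop)
  set g : ℝ → ℝ → ℝ := fun x σ => ∫ y, (w (y + x) σ * φ₂ y + f (w (y + x) σ) * φ y) with hg
  have hgb : ∀ x σ, |g x σ| ≤ ∫ y, b y := fun x σ => by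
    rw [← Real.norm_eq_abs]
    exact norm_integral_le_of_norm_le ib (ae_of_all _ fun y => hbound y (y + x) σ)
  have hgc : ∀ x, ContinuousOn (g x) (Icc s t) := fun x σ hσ => by
    refine continuousWithinAt_of_dominated (bound := b) ?_
      (Eventually.of_forall fun τ => ae_of_all _ fun y => hbound y (y + x) τ) ib ?_
    · filter_upwards [self_mem_nhdsWithin] with τ hτ using hmeas τ (hs.trans hτ.1) x
    · refine ae_of_all _ fun y => ?_
      have h1 : ContinuousWithinAt (w (y + x)) (Icc s t) σ :=
        (h.ct (y + x) σ (hs.trans hσ.1)).mono fun τ hτ => hs.trans hτ.1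
      exact (h1.mul continuousWithinAt_const).add
        ((hf.continuousAt.comp_continuousWithinAt h1).mul continuousWithinAt_const)
  have hwφ : ∀ x σ, ∀ᵐ y, ‖w (y + x) σ * φ y‖ ≤ M * |φ y| := fun x σ => ae_of_all _ fun y => by
    rw [Real.norm_eq_abs, abs_mul]
    gcongr
    exact h.bd _ _
  have hwφm : ∀ σ, 0 ≤ σ → ∀ x, AEStronglyMeasurable (fun y => w (y + x) σ * φ y) volume :=
    fun σ hσ x => by
      have := h.cx σ hσ
      exact Continuous.aestronglyMeasurable (by fun_prop)
  have hshift : ∀ σ, 0 ≤ σ → ∀ y, Tendsto (fun x => w (y + x) σ) atTop (𝓝 (Θ σ)) :=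
    fun σ hσ y => (hΘ σ hσ).comp (tendsto_atTop_add_const_left _ y tendsto_id)
  have hUc : ∀ x, ContinuousOn (fun σ => ∫ y, w (y + x) σ * φ y) (Icc s t) := fun x σ hσ => by
    refine continuousWithinAt_of_dominated (bound := fun y => M * |φ y|) ?_
      (Eventually.of_forall fun τ => hwφ x τ) (iφ.abs.const_mul M) ?_
    · filter_upwards [self_mem_nhdsWithin] with τ hτ using hwφm τ (hs.trans hτ.1) x
    · refine ae_of_all _ fun y => ?_
      exact ((h.ct (y + x) σ (hs.trans hσ.1)).mono fun τ hτ => hs.trans hτ.1).mul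
        continuousWithinAt_const
  have hFTC : ∀ x, ∫ σ in s..t, g x σ =
      (∫ y, w (y + x) t * φ y) - ∫ y, w (y + x) s * φ y := fun x => by
    refine intervalIntegral.integral_eq_sub_of_hasDeriv_right
      (f := fun σ => ∫ y, w (y + x) σ * φ y) (by simpa [uIcc_of_le hst] using hUc x)
      (fun σ hσ => ?_)
      (ContinuousOn.intervalIntegrable (by simpa [uIcc_of_le hst] using hgc x))
    rw [min_eq_left hst] at hσ
    exact ((h.weak _ σ (hs.trans_lt hσ.1)).translate x φ φ₁ φ₂ hφ).mono Ioi_subset_Ici_self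
  have hU : ∀ σ, 0 ≤ σ → Tendsto (fun x => ∫ y, w (y + x) σ * φ y) atTop (𝓝 (Θ σ)) := by
    intro σ hσ
    have := tendsto_integral_filter_of_dominated_convergence (l := atTop)
      (F := fun x y => w (y + x) σ * φ y) (f := fun y => Θ σ * φ y) (fun y => M * |φ y|)
      (Eventually.of_forall (hwφm σ hσ)) (Eventually.of_forall fun x => hwφ x σ)
      (iφ.abs.const_mul M) (ae_of_all _ fun y => (hshift σ hσ y).mul_const _)
    rwa [integral_const_mul, hφ1, mul_one] at this
  have hglim : ∀ σ, 0 ≤ σ → Tendsto (fun x => g x σ) atTop (𝓝 (f (Θ σ))) := by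
    intro σ hσ
    have := tendsto_integral_filter_of_dominated_convergence (l := atTop)
      (F := fun x y => w (y + x) σ * φ₂ y + f (w (y + x) σ) * φ y)
      (f := fun y => Θ σ * φ₂ y + f (Θ σ) * φ y) b
      (Eventually.of_forall (hmeas σ hσ))
      (Eventually.of_forall fun x => ae_of_all _ fun y => hbound y (y + x) σ) ib
      (ae_of_all _ fun y => ((hshift σ hσ y).mul_const _).add
        (((hf.tendsto _).comp (hshift σ hσ y)).mul_const _))
    rwa [integral_add (iφ₂.const_mul _) (iφ.const_mul _), integral_const_mul, integral_const_mul,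
      hφ1, hφ.integral_deriv₂, mul_zero, zero_add, mul_one] at this
  have hlim : Tendsto (fun x => ∫ σ in s..t, g x σ) atTop (𝓝 (∫ σ in s..t, f (Θ σ))) := by
    refine intervalIntegral.tendsto_integral_filter_of_dominated_convergence
      (fun _ => ∫ y, b y) (Eventually.of_forall fun x => ?_)
      (Eventually.of_forall fun x => ae_of_all _ fun σ _ => hgb x σ)
      intervalIntegrable_const (ae_of_all _ fun σ hσ => ?_)
    · rw [uIoc_of_le hst]
      exact ((hgc x).mono Ioc_subset_Icc_self).aestronglyMeasurable measurableSet_Ioc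
    · rw [uIoc_of_le hst] at hσ
      exact hglim σ (hs.trans hσ.1.le)
  refine tendsto_nhds_unique hlim ?_
  simp_rw [hFTC]
  exact (hU t (hs.trans hst)).sub (hU s hs)

lemma IsWeakSol.exists_limit_ode {K : NNReal} (h : IsWeakSol f M w) (hf : LipschitzWith K f)
    {F : ℝ} (hF : ∀ x t, |f (w x t)| ≤ F) {θ : ℝ}
    (hθ : Tendsto (fun y => w y 0) atTop (𝓝 θ)) :
    ∃ Θ : ℝ → ℝ, Θ 0 = θ ∧ ContinuousOn Θ (Ici 0) ∧
      (∀ t, 0 < t → Tendsto (fun y => w y t) atTop (𝓝 (Θ t))) ∧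
      ∀ t, 0 < t → HasDerivAt Θ (f (Θ t)) t := by
  choose! Θ hΘ using fun t (ht : 0 ≤ t) => h.exists_tendsto_atTop hf hθ ht
  have hint {s t : ℝ} (hs : 0 ≤ s) (hst : s ≤ t) : ∫ σ in s..t, f (Θ σ) = Θ t - Θ s :=
    h.limit_integral_eq hf.continuous hF hΘ hs hst
  have hfΘ : ∀ t, 0 ≤ t → |f (Θ t)| ≤ F := fun t ht =>
    le_of_tendsto ((hf.continuous.tendsto _).comp (hΘ t ht)).abs
      (Eventually.of_forall fun y => hF y t)
  have hF0 : 0 ≤ F := (abs_nonneg _).trans (hF 0 0)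
  have hlip : ∀ s t, 0 ≤ s → s ≤ t → |Θ t - Θ s| ≤ F * |t - s| := fun s t hs hst => by
    rw [← hint hs hst, ← Real.norm_eq_abs]
    refine intervalIntegral.norm_integral_le_of_norm_le_const fun σ hσ => ?_
    rw [uIoc_of_le hst] at hσ
    exact hfΘ σ (hs.trans hσ.1.le)
  have hcont : ContinuousOn Θ (Ici 0) := by
    refine LipschitzOnWith.continuousOn (K := F.toNNReal) (LipschitzOnWith.of_dist_le_mul ?_)
    intro s hs t ht
    rw [Real.dist_eq, Real.dist_eq, Real.coe_toNNReal F hF0]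
    rcases le_total s t with hst | hst
    · rw [abs_sub_comm (Θ s), abs_sub_comm s]
      exact hlip s t hs hst
    · exact hlip t s ht hst
  have hfc : ContinuousOn (fun σ => f (Θ σ)) (Ici 0) := hf.continuous.comp_continuousOn hcont
  refine ⟨Θ, tendsto_nhds_unique (hΘ 0 le_rfl) hθ, hcont, fun t ht => hΘ t ht.le, fun t ht => ?_⟩
  have hd := intervalIntegral.integral_hasDerivAt_right (a := 0) (b := t)
    (f := fun σ => f (Θ σ))
    (ContinuousOn.intervalIntegrable (hfc.mono (by
      rw [uIcc_of_le ht.le]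
      exact Icc_subset_Ici_self)))
    ((hfc.mono Ioi_subset_Ici_self).stronglyMeasurableAtFilter isOpen_Ioi t ht)
    (hfc.continuousAt (Ici_mem_nhds ht))
  refine (hd.const_add (Θ 0)).congr_of_eventuallyEq ?_
  filter_upwards [lt_mem_nhds ht] with τ hτ
  rw [hint le_rfl hτ.le]
  ring

end Limit

lemma IsSol.exists_limit_ode {f : ℝ → ℝ} {M : ℝ} {u : ℝ → ℝ → ℝ} {K : NNReal} (h : IsSol f M u)
    (hf : LipschitzWith K f) {u₀ : ℝ → ℝ} (hu₀ : Continuous u₀) {θ : ℝ}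
    (hθ : Tendsto u₀ atTop (𝓝 θ)) (hinit : ∀ x, Tendsto (u x) (𝓝[>] 0) (𝓝 (u₀ x))) :
    ∃ Θ : ℝ → ℝ, Θ 0 = θ ∧ ContinuousOn Θ (Ici 0) ∧
      (∀ t, 0 < t → Tendsto (fun y => u y t) atTop (𝓝 (Θ t))) ∧
      ∀ t, 0 < t → HasDerivAt Θ (f (Θ t)) t := by
  have hFM : ∀ z, |z| ≤ M → |f z| ≤ |f 0| + K * M := fun z hz => by
    have h1 := hf.dist_le_mul z 0
    rw [Real.dist_eq, Real.dist_eq, sub_zero] at h1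
    have h2 := abs_sub_abs_le_abs_sub (f z) (f 0)
    have h3 := mul_le_mul_of_nonneg_left hz K.coe_nonneg
    linarith
  have hw := h.isWeakSol hf.continuous (fun x t => hFM _ (h.bd x t)) hu₀ hinit
  obtain ⟨Θ, h0, hc, hlim, hd⟩ := hw.exists_limit_ode hf (fun x t => hFM _ (hw.bd x t))
    (θ := θ) (by simpa using hθ)
  refine ⟨Θ, h0, hc, fun t ht => ?_, hd⟩
  simpa only [if_neg (not_le.2 ht)] using hlim t ht

lemma IsSol.reflect {f : ℝ → ℝ} {M : ℝ} {u : ℝ → ℝ → ℝ} (h : IsSol f M u) :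
    IsSol f M fun x t => u (-x) t := by
  refine ⟨fun x t => h.bd (-x) t, fun t ht => (h.c2 t ht).comp contDiff_neg, fun x t ht => ?_⟩
  have e1 : (deriv fun y => u (-y) t) = fun y => -deriv (fun y => u y t) (-y) :=
    funext fun y => deriv_comp_neg (fun y => u y t) y
  have e2 : deriv (deriv fun y => u (-y) t) x = deriv (deriv fun y => u y t) (-x) := by
    rw [e1, deriv.fun_neg, deriv_comp_neg (deriv fun y => u y t), neg_neg]
  rw [e2]
  exact h.pde (-x) t ht

/-- If `u` is a bounded solution of `u_t = u_xx + f(u)` whose initial value `u₀` has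
finite limits `θ∓` at `∓∞`, then for each `t > 0` the limits `Θ∓(t)` of `u(·,t)` at
`∓∞` exist and solve `Θ' = f(Θ)` with `Θ∓(0) = θ∓`. -/
theorem stmt_9 (f : ℝ → ℝ) (K : NNReal) (hf : LipschitzWith K f)
    (u : ℝ → ℝ → ℝ) (M : ℝ) (hbd : ∀ x t, |u x t| ≤ M)
    (hx2 : ∀ t, 0 < t → ContDiff ℝ 2 (fun y => u y t))
    (hpde : ∀ x t, 0 < t →
      HasDerivAt (fun τ => u x τ) (deriv (deriv (fun y => u y t)) x + f (u x t)) t)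
    (u₀ : ℝ → ℝ) (hu₀ : Continuous u₀)
    (θm θp : ℝ)
    (hlimB : Filter.Tendsto u₀ Filter.atBot (nhds θm))
    (hlimT : Filter.Tendsto u₀ Filter.atTop (nhds θp))
    (hinit : ∀ x, Filter.Tendsto (fun t => u x t) (nhdsWithin 0 (Set.Ioi 0)) (nhds (u₀ x))) :
    ∃ Θm Θp : ℝ → ℝ, Θm 0 = θm ∧ Θp 0 = θp ∧
      ContinuousOn Θm (Set.Ici 0) ∧ ContinuousOn Θp (Set.Ici 0) ∧
      (∀ t, 0 < t → Filter.Tendsto (fun x => u x t) Filter.atBot (nhds (Θm t)) ∧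
        Filter.Tendsto (fun x => u x t) Filter.atTop (nhds (Θp t))) ∧
      (∀ t, 0 < t → HasDerivAt Θm (f (Θm t)) t ∧ HasDerivAt Θp (f (Θp t)) t) := by
  have h : IsSol f M u := ⟨hbd, hx2, hpde⟩
  obtain ⟨Θp, hp0, hpc, hplim, hpd⟩ := h.exists_limit_ode hf hu₀ hlimT hinit
  obtain ⟨Θm, hm0, hmc, hmlim, hmd⟩ := h.reflect.exists_limit_ode hf (u₀ := fun x => u₀ (-x))
    (hu₀.comp continuous_neg) (hlimB.comp tendsto_neg_atTop_atBot) fun x => hinit (-x)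
  refine ⟨Θm, Θp, hm0, hp0, hmc, hpc, fun t ht => ⟨?_, hplim t ht⟩,
    fun t ht => ⟨hmd t ht, hpd t ht⟩⟩
  simpa [Function.comp_def] using (hmlim t ht).comp tendsto_neg_atBot_atTop
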